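/- Let ε>0 be a constant and let p = p(n) satisfy p < (2^{-7/3} − ε)·n^{-1/3}. Let G ~ G_{n,p}. Then with high probability there is no tree T ⊆ G of diameter at most n^{1/18−ε} such that T activates G, i.e. no such tree T with T → G in the K_3-bootstrap percolation process. -/

import Mathlib

namespace WSat

variable {V : Type} [Fintype V] [DecidableEq V]

/-- The number of (non-isolated) vertices of `G`. -/
noncomputable def supportCard (G : SimpleGraph V) : ℕ := Nat.card G.support

/-- The number of edges of `G`. -/
noncomputable def edgeCard (G : SimpleGraph V) : ℕ := Nat.card G.edgeSet

/-- One step of `K₃`-bootstrap percolation inside an ambient graph `G`: the graph `B` is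
obtained from `A` by adding a single edge of `G` that lies in a triangle of `B`. -/
def BootStep (G A B : SimpleGraph V) : Prop :=
  ∃ u v : V, G.Adj u v ∧ ¬ A.Adj u v ∧
    B = A ⊔ SimpleGraph.fromEdgeSet {s(u, v)} ∧ ∃ w : V, A.Adj u w ∧ A.Adj v w

/-- `H` activates `G'` in `G` (written `H → G'` in the paper). -/
def Activates (G H G' : SimpleGraph V) : Prop :=
  H ≤ G ∧ Relation.ReflTransGen (BootStep G) H G'

open scoped Classical in
/-- The probability that the binomial random graph `G_{n,p}` (on vertex set `Fin n`, each
of the `n.choose 2` possible edges present independently with probability `p`) belongs to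
the set `A`. -/
noncomputable def gnpProb (n : ℕ) (p : ℝ) (A : Set (SimpleGraph (Fin n))) : ℝ :=
  ∑ G : SimpleGraph (Fin n),
    if G ∈ A then p ^ edgeCard G * (1 - p) ^ (n.choose 2 - edgeCard G) else 0

end WSat

namespace WSat
open Finset
set_option linter.unusedSectionVars false

section chains
variable {V : Type} [Fintype V] [DecidableEq V]

/-- indicator chain of an edge -/
def sg (e : Sym2 V) : Sym2 V → ZMod 2 := fun f => if f = e then 1 else 0

/-- boundary of a triangle (as a vertex set) -/
def bd (t : Finset V) : Sym2 V → ZMod 2 := fun e => if e ∈ t.sym2 ∧ ¬ e.IsDiag then 1 else 0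

/-- boundary of a set of triangles -/
def Bd (S : Finset (Finset V)) : Sym2 V → ZMod 2 := ∑ t ∈ S, bd t

def EvenC (c : Sym2 V → ZMod 2) : Prop :=
  (∀ v, c s(v, v) = 0) ∧ ∀ v, ∑ w, c s(v, w) = 0

lemma EvenC.add {c d : Sym2 V → ZMod 2} (hc : EvenC c) (hd : EvenC d) : EvenC (c + d) := by
  refine ⟨fun v => by simp [hc.1 v, hd.1 v], fun v => ?_⟩
  simp [Finset.sum_add_distrib, hc.2 v, hd.2 v]

lemma EvenC.zero : EvenC (0 : Sym2 V → ZMod 2) := ⟨fun _ => rfl, fun _ => by simp⟩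

lemma EvenC.sum {ι : Type} (s : Finset ι) (f : ι → Sym2 V → ZMod 2)
    (h : ∀ i ∈ s, EvenC (f i)) : EvenC (∑ i ∈ s, f i) := by
  classical
  induction s using Finset.induction_on with
  | empty => simpa using EvenC.zero
  | insert a s ha ih =>
    rw [Finset.sum_insert ha]
    exact (h a (by simp)).add (ih fun i hi => h i (by simp [hi]))

lemma chain_add_self (c : Sym2 V → ZMod 2) : c + c = 0 := by
  funext e
  exact CharTwo.add_self_eq_zero (c e)

lemma zmod2_cases (x : ZMod 2) : x = 0 ∨ x = 1 := by
  fin_cases x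
  · left; rfl
  · right; rfl

lemma zmod2_ne (x : ZMod 2) (h : x ≠ 0) : x = 1 := (zmod2_cases x).resolve_left h

lemma evenC_bd (t : Finset V) (ht : t.card = 3) : EvenC (bd t) := by
  refine ⟨fun v => by simp [bd], fun v => ?_⟩
  by_cases hv : v ∈ t
  · have : ∀ w, bd t s(v, w) = if w ∈ t.erase v then 1 else 0 := by
      intro w
      simp only [bd, Finset.mk_mem_sym2_iff, hv, true_and, Sym2.mk_isDiag_iff, mem_erase]
      congr 1
      apply propext
      constructor
      · rintro ⟨h1, h2⟩; exact ⟨fun h => h2 h.symm, h1⟩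
      · rintro ⟨h1, h2⟩; exact ⟨h2, fun h => h1 h.symm⟩
    simp only [this]
    rw [Finset.sum_ite_mem, Finset.univ_inter, Finset.sum_const, Finset.card_erase_of_mem hv, ht]
    rfl
  · apply Finset.sum_eq_zero
    intro w _
    simp [bd, hv]

lemma evenC_Bd (S : Finset (Finset V)) (hS : ∀ t ∈ S, t.card = 3) : EvenC (Bd S) :=
  EvenC.sum _ _ fun t ht => evenC_bd t (hS t ht)

lemma Bd_symmDiff (S T : Finset (Finset V)) : Bd (symmDiff S T) = Bd S + Bd T := by
  have h1 : Bd S = Bd (S \ T) + Bd (S ∩ T) := by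
    unfold Bd; rw [← Finset.sum_union (Finset.disjoint_sdiff_inter S T), Finset.sdiff_union_inter]
  have h2 : Bd T = Bd (T \ S) + Bd (S ∩ T) := by
    unfold Bd
    rw [Finset.inter_comm, ← Finset.sum_union (Finset.disjoint_sdiff_inter T S),
      Finset.sdiff_union_inter]
  have h3 : Bd (symmDiff S T) = Bd (S \ T) + Bd (T \ S) := by
    unfold Bd
    rw [← Finset.sum_union]
    · rfl
    · exact disjoint_sdiff_sdiff
  rw [h1, h2, h3]
  have := chain_add_self (Bd (S ∩ T))
  calc Bd (S \ T) + Bd (T \ S) = Bd (S \ T) + Bd (T \ S) + 0 := by simp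
    _ = _ := by rw [← this]; abel

lemma sum_symm_zero (U : Finset V) (c : Sym2 V → ZMod 2) (hd : ∀ v, c s(v, v) = 0) :
    ∑ x ∈ U, ∑ w ∈ U, c s(x, w) = 0 := by
  induction U using Finset.induction_on with
  | empty => simp
  | insert a s ha ih =>
    rw [Finset.sum_insert ha, Finset.sum_insert ha, hd]
    have : ∀ x ∈ s, ∑ w ∈ insert a s, c s(x, w) = c s(a, x) + ∑ w ∈ s, c s(x, w) := by
      intro x _
      rw [Finset.sum_insert ha, Sym2.eq_swap]
    rw [Finset.sum_congr rfl this, Finset.sum_add_distrib, ih]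
    simp [CharTwo.add_self_eq_zero]

lemma EvenC.cut {c : Sym2 V → ZMod 2} (hc : EvenC c) (U : Finset V) :
    ∑ x ∈ U, ∑ w ∈ Uᶜ, c s(x, w) = 0 := by
  have h1 : ∑ x ∈ U, ∑ w, c s(x, w) = 0 := Finset.sum_eq_zero fun x _ => hc.2 x
  have h2 : ∀ x, ∑ w, c s(x, w) = ∑ w ∈ U, c s(x, w) + ∑ w ∈ Uᶜ, c s(x, w) := by
    intro x
    rw [Finset.sum_add_sum_compl]
  simp only [h2, Finset.sum_add_distrib, sum_symm_zero U c hc.1, zero_add] at h1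
  exact h1

lemma forest_even_zero (T : SimpleGraph V) (hT : T.IsAcyclic) (c : Sym2 V → ZMod 2)
    (hc : EvenC c) (hs : ∀ e, c e ≠ 0 → e ∈ T.edgeSet) : c = 0 := by
  classical
  by_contra hne
  obtain ⟨e, he⟩ : ∃ e, c e ≠ 0 := by
    by_contra h; push Not at h; exact hne (funext h)
  have heT := hs e he
  have hb := SimpleGraph.isAcyclic_iff_forall_isBridge.mp hT heT
  induction e using Sym2.ind with
  | _ u v =>
  rw [SimpleGraph.isBridge_iff] at hb
  set T' := T.deleteEdges {s(u, v)} with hT'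
  let U : Finset V := univ.filter fun x => T'.Reachable u x
  have hu : u ∈ U := by simp [U]
  have hv : v ∉ U := by
    simp only [U, mem_filter, mem_univ, true_and]
    first
      | exact hb.2
      | exact hb
  have hcut := hc.cut U
  have key : ∀ x ∈ U, ∀ w ∈ Uᶜ, c s(x, w) ≠ 0 → x = u ∧ w = v := by
    intro x hx w hw hcw
    have hadj := hs _ hcw
    by_contra hnot
    have : T'.Adj x w := by
      rw [hT', SimpleGraph.deleteEdges_adj]
      refine ⟨hadj, ?_⟩
      rw [Set.mem_singleton_iff, Sym2.eq_iff]
      rintro (h | ⟨h1, h2⟩)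
      · exact hnot h
      · subst h1; exact hv hx
    simp only [U, mem_filter, mem_univ, true_and, mem_compl] at hx hw
    exact hw (hx.trans this.reachable)
  rw [Finset.sum_eq_single_of_mem u hu, Finset.sum_eq_single_of_mem v (by simpa using hv)] at hcut
  · exact he hcut
  · intro w hw hwv
    by_contra h
    exact hwv (key u hu w hw h).2
  · intro x hx hxu
    apply Finset.sum_eq_zero
    intro w hw
    by_contra h
    exact hxu (key x hx w hw h).1

/-- the chain of a list of edges -/
def lc (l : List (Sym2 V)) : Sym2 V → ZMod 2 := (l.map sg).sum

@[simp] lemma lc_nil : lc ([] : List (Sym2 V)) = 0 := rfl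
@[simp] lemma lc_cons (e : Sym2 V) (l) : lc (e :: l) = sg e + lc l := by simp [lc]
lemma lc_append (l m : List (Sym2 V)) : lc (l ++ m) = lc l + lc m := by simp [lc]

lemma lc_ne_zero_mem (l : List (Sym2 V)) (e : Sym2 V) (h : lc l e ≠ 0) : e ∈ l := by
  induction l with
  | nil => simp at h
  | cons a l ih =>
    by_cases hea : e = a
    · simp [hea]
    · simp only [lc_cons, Pi.add_apply, sg, if_neg hea, zero_add] at h
      exact List.mem_cons_of_mem _ (ih h)

lemma sg_star (u v : V) (huv : u ≠ v) (x : V) :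
    ∑ w, sg s(u, v) s(x, w) = (if x = u then 1 else 0) + (if x = v then 1 else 0) := by
  have : ∀ w, sg s(u, v) s(x, w) =
      (if x = u ∧ w = v then 1 else 0) + (if x = v ∧ w = u then (1 : ZMod 2) else 0) := by
    intro w
    simp only [sg, Sym2.eq_iff]
    by_cases h1 : x = u ∧ w = v
    · have : ¬ (x = v ∧ w = u) := fun h => huv (h1.1.symm.trans h.1)
      simp [h1, huv]
    · simp only [h1, false_or, if_false, zero_add]
  simp only [this, Finset.sum_add_distrib]
  congr 1
  · by_cases h : x = u <;> simp [h]
  · by_cases h : x = v <;> simp [h]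

lemma sg_diag (u v : V) (huv : u ≠ v) (x : V) : sg s(u, v) s(x, x) = 0 := by
  unfold sg
  rw [if_neg]
  rw [Sym2.eq_iff]
  rintro (⟨h1, h2⟩ | ⟨h1, h2⟩)
  · exact huv (h1.symm.trans h2)
  · exact huv (h2.symm.trans h1)

/-- boundary of a chain of a walk -/
lemma walk_lc_star {G : SimpleGraph V} {u v : V} (q : G.Walk u v) (x : V) :
    ∑ w, lc q.edges s(x, w) = (if x = u then 1 else 0) + (if x = v then 1 else 0) := by
  induction q with
  | nil => simp [CharTwo.add_self_eq_zero]
  | cons h q ih =>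
    simp only [SimpleGraph.Walk.edges_cons, lc_cons, Pi.add_apply, Finset.sum_add_distrib, ih,
      sg_star _ _ h.ne]
    generalize (if x = _ then (1 : ZMod 2) else 0) = a
    generalize (if x = _ then (1 : ZMod 2) else 0) = b
    generalize (if x = _ then (1 : ZMod 2) else 0) = c
    rw [add_assoc, ← add_assoc b b c, CharTwo.add_self_eq_zero, zero_add]

lemma walk_lc_diag {G : SimpleGraph V} {u v : V} (q : G.Walk u v) (x : V) :
    lc q.edges s(x, x) = 0 := by
  by_contra h
  have := q.edges_subset_edgeSet (lc_ne_zero_mem _ _ h)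
  simp at this

/-- support of a chain -/
def spt (c : Sym2 V → ZMod 2) : Finset (Sym2 V) := univ.filter fun e => c e ≠ 0

@[simp] lemma mem_spt (c : Sym2 V → ZMod 2) (e) : e ∈ spt c ↔ c e ≠ 0 := by simp [spt]

lemma bd_triangle (u v w : V) (huv : u ≠ v) (huw : u ≠ w) (hvw : v ≠ w) :
    bd {u, v, w} = sg s(u, v) + sg s(u, w) + sg s(w, v) := by
  funext e
  induction e using Sym2.ind with
  | _ a b =>
  simp only [bd, sg, Pi.add_apply, mk_mem_sym2_iff, mem_insert, mem_singleton,
    Sym2.mk_isDiag_iff, Sym2.eq_iff]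
  by_cases h1 : a = u <;> by_cases h2 : a = v <;> by_cases h3 : a = w <;>
  by_cases h4 : b = u <;> by_cases h5 : b = v <;> by_cases h6 : b = w <;> simp_all

end chains
end WSat

namespace WSat
open Finset
set_option linter.unusedSectionVars false

section fillings
variable {V : Type} [Fintype V] [DecidableEq V]

/-- all members of `S` are triangles of `G` -/
def IsTri (G : SimpleGraph V) (S : Finset (Finset V)) : Prop := ∀ t ∈ S, G.IsNClique 3 t

/-- `e` has a filling of size at most `k` relative to `T`. -/
def Fill (G T : SimpleGraph V) (k : ℕ) (e : Sym2 V) : Prop :=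
  ∃ S : Finset (Finset V), IsTri G S ∧ S.card ≤ k ∧ ∀ f, (Bd S + sg e) f ≠ 0 → f ∈ T.edgeSet

lemma Bd_empty : Bd (∅ : Finset (Finset V)) = 0 := by simp [Bd]
lemma Bd_singleton (t : Finset V) : Bd ({t} : Finset (Finset V)) = bd t := by simp [Bd]

lemma Fill.mono {G T : SimpleGraph V} {k l : ℕ} {e : Sym2 V} (h : Fill G T k e) (hkl : k ≤ l) :
    Fill G T l e := by
  obtain ⟨S, h1, h2, h3⟩ := h
  exact ⟨S, h1, h2.trans hkl, h3⟩

lemma fill_of_mem (G T : SimpleGraph V) (k : ℕ) (e : Sym2 V) (he : e ∈ T.edgeSet) :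
    Fill G T k e := by
  refine ⟨∅, by simp [IsTri], by simp, fun f hf => ?_⟩
  rw [Bd_empty, zero_add] at hf
  have : f = e := by
    by_contra h; simp [sg, h] at hf
  exact this ▸ he

lemma IsTri.symmDiff {G : SimpleGraph V} {S S' : Finset (Finset V)} (h : IsTri G S)
    (h' : IsTri G S') : IsTri G (symmDiff S S') := by
  intro t ht
  rw [Finset.mem_symmDiff] at ht
  rcases ht with ⟨h1, _⟩ | ⟨h1, _⟩
  · exact h t h1
  · exact h' t h1

lemma card_symmDiff_le (S S' : Finset (Finset V)) :
    (symmDiff S S').card ≤ S.card + S'.card := by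
  calc (symmDiff S S').card ≤ (S ∪ S').card := by
        apply Finset.card_le_card
        exact symmDiff_le_sup
    _ ≤ _ := Finset.card_union_le _ _

lemma fill_step {G T : SimpleGraph V} {k l : ℕ} {u v w : V} (huv : G.Adj u v)
    (huw : G.Adj u w) (hvw : G.Adj v w) (h1 : Fill G T k s(u, w)) (h2 : Fill G T l s(v, w)) :
    Fill G T (k + l + 1) s(u, v) := by
  obtain ⟨S, a1, a2, a3⟩ := h1
  obtain ⟨S', b1, b2, b3⟩ := h2
  refine ⟨symmDiff (symmDiff S S') {{u, v, w}}, ?_, ?_, ?_⟩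
  · apply IsTri.symmDiff (a1.symmDiff b1)
    intro t ht
    rw [Finset.mem_singleton] at ht
    subst ht
    rw [SimpleGraph.is3Clique_triple_iff]
    exact ⟨huv, huw, hvw⟩
  · refine (card_symmDiff_le _ _).trans ?_
    have := card_symmDiff_le S S'
    simp only [card_singleton]
    omega
  · intro f hf
    have e1 : Bd (symmDiff (symmDiff S S') {{u, v, w}}) + sg s(u, v) =
        (Bd S + sg s(u, w)) + (Bd S' + sg s(v, w)) := by
      rw [Bd_symmDiff, Bd_symmDiff, Bd_singleton, bd_triangle u v w huv.ne huw.ne hvw.ne,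
        Sym2.eq_swap (a := w)]
      have := chain_add_self (sg s(u, v))
      calc _ = (Bd S + sg s(u, w)) + (Bd S' + sg s(v, w)) + (sg s(u, v) + sg s(u, v)) := by abel
        _ = _ := by rw [this, add_zero]
    rw [e1] at hf
    by_contra hcon
    apply hf
    have c1 : (Bd S + sg s(u, w)) f = 0 := by
      by_contra h; exact hcon (a3 f h)
    have c2 : (Bd S' + sg s(v, w)) f = 0 := by
      by_contra h; exact hcon (b3 f h)
    rw [Pi.add_apply, c1, c2, add_zero]

lemma process_fill (G T H : SimpleGraph V) (L : ℕ) (hTG : T ≤ G)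
    (hr : Relation.ReflTransGen (BootStep G) T H) :
    H ≤ G ∧ ((∀ e ∈ H.edgeSet, Fill G T L e) ∨
      ∃ e ∈ G.edgeSet, Fill G T (2 * L + 1) e ∧ ¬ Fill G T L e) := by
  induction hr with
  | refl => exact ⟨hTG, Or.inl fun e he => fill_of_mem _ _ _ _ he⟩
  | tail _ hstep ih =>
    rename_i B C _
    obtain ⟨u, v, huv, hB, hC, w, hw1, hw2⟩ := hstep
    have hCG : C ≤ G := by
      rw [hC]
      apply sup_le ih.1
      intro a b hab
      simp only [SimpleGraph.fromEdgeSet_adj, Set.mem_singleton_iff, Sym2.eq_iff] at hab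
      rcases hab.1 with ⟨rfl, rfl⟩ | ⟨rfl, rfl⟩
      · exact huv
      · exact huv.symm
    refine ⟨hCG, ?_⟩
    rcases ih.2 with h | h
    · by_cases hf : Fill G T L s(u, v)
      · left
        intro e he
        rw [hC, SimpleGraph.edgeSet_sup] at he
        rcases he with he | he
        · exact h e he
        · rw [SimpleGraph.edgeSet_fromEdgeSet] at he
          have := he.1
          rw [Set.mem_singleton_iff] at this
          exact this ▸ hf
      · right
        refine ⟨s(u, v), huv, ?_, hf⟩
        have := fill_step huv (ih.1 hw1) (ih.1 hw2) (h s(u, w) hw1) (h s(v, w) hw2)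
        exact this.mono (by omega)
    · exact Or.inr h

/-- Irreducible set of triples. -/
def Irr (S : Finset (Finset V)) : Prop :=
  (∀ t ∈ S, t.card = 3) ∧ (spt (Bd S)).Nonempty ∧
    ∀ S1 ⊆ S, spt (Bd S1) ⊆ spt (Bd S) → S1 = ∅ ∨ S1 = S

/-- minimal even chain -/
def MinEven (z : Sym2 V → ZMod 2) : Prop :=
  z ≠ 0 ∧ ∀ c, EvenC c → spt c ⊆ spt z → c = 0 ∨ c = z

lemma spt_nonempty {z : Sym2 V → ZMod 2} (h : z ≠ 0) : (spt z).Nonempty := by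
  by_contra hne
  rw [Finset.not_nonempty_iff_eq_empty] at hne
  apply h
  funext e
  by_contra he
  have : e ∈ spt z := by simpa using he
  simp [hne] at this

lemma exists_irr (G : SimpleGraph V) (z : Sym2 V → ZMod 2) (hz : MinEven z)
    (S0 : Finset (Finset V)) (h0 : IsTri G S0) (hS0 : Bd S0 = z) :
    ∃ S, IsTri G S ∧ Bd S = z ∧ S.card ≤ S0.card ∧ Irr S := by
  classical
  let F : Finset (Finset (Finset V)) := univ.filter fun S => IsTri G S ∧ Bd S = z
  have hF : S0 ∈ F := by simp [F, h0, hS0]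
  obtain ⟨S, hS, hmin⟩ := Finset.exists_min_image F Finset.card ⟨S0, hF⟩
  simp only [F, mem_filter, mem_univ, true_and] at hS hmin
  refine ⟨S, hS.1, hS.2, hmin S0 ⟨h0, hS0⟩, fun t ht => (hS.1 t ht).2, ?_, ?_⟩
  · rw [hS.2]; exact spt_nonempty hz.1
  · intro S1 hS1 hsub
    rw [hS.2] at hsub
    have h3 : EvenC (Bd S1) := evenC_Bd S1 fun t ht => (hS.1 t (hS1 ht)).2
    rcases hz.2 _ h3 hsub with h | h
    · left
      have e1 : Bd (S \ S1) = z := by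
        have : symmDiff S S1 = S \ S1 := by
          ext t; simp only [mem_symmDiff, mem_sdiff]
          constructor
          · rintro (h | h)
            · exact h
            · exact absurd (hS1 h.1) h.2
          · intro h; exact Or.inl h
        rw [← this, Bd_symmDiff, hS.2, h, add_zero]
      have := hmin (S \ S1) ⟨fun t ht => hS.1 t (mem_sdiff.mp ht).1, e1⟩
      rw [Finset.card_sdiff_of_subset hS1] at this
      have h5 := Finset.card_le_card hS1
      have : S1.card = 0 := by omega
      exact Finset.card_eq_zero.mp this
    · right
      have := hmin S1 ⟨fun t ht => hS.1 t (hS1 ht), h⟩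
      exact Finset.eq_of_subset_of_card_le hS1 this

lemma sg_self (e : Sym2 V) : sg e e = 1 := by simp [sg]

lemma evenC_of_path {T : SimpleGraph V} {u v : V} (huv : u ≠ v) (q : T.Walk u v) :
    EvenC (sg s(u, v) + lc q.edges) := by
  constructor
  · intro x
    rw [Pi.add_apply, sg_diag u v huv, walk_lc_diag, add_zero]
  · intro x
    simp only [Pi.add_apply, Finset.sum_add_distrib, sg_star u v huv, walk_lc_star]
    exact CharTwo.add_self_eq_zero _

/-- a bad edge gives an irreducible set with small boundary. -/
lemma bad_edge (G T : SimpleGraph V) (hT : T.IsTree) (L B : ℕ)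
    (hdist : ∀ u v, T.dist u v + 1 ≤ B) (e : Sym2 V) (he : e ∈ G.edgeSet)
    (h1 : Fill G T (2 * L + 1) e) (h2 : ¬ Fill G T L e) :
    ∃ S, IsTri G S ∧ Irr S ∧ L < S.card ∧ S.card ≤ 2 * L + 1 ∧ (spt (Bd S)).card ≤ B := by
  induction e using Sym2.ind with
  | _ u v =>
  have huv : u ≠ v := SimpleGraph.Adj.ne he
  have heT : s(u, v) ∉ T.edgeSet := fun h => h2 (fill_of_mem _ _ _ _ h)
  obtain ⟨S0, a1, a2, a3⟩ := h1
  obtain ⟨q, hq⟩ := hT.connected.exists_walk_length_eq_dist u v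
  set z := sg s(u, v) + lc q.edges with hz
  have hzT : ∀ f, f ≠ s(u, v) → z f ≠ 0 → f ∈ T.edgeSet := by
    intro f hf hzf
    rw [hz, Pi.add_apply] at hzf
    simp only [sg, if_neg hf, zero_add] at hzf
    exact q.edges_subset_edgeSet (lc_ne_zero_mem _ _ hzf)
  have hze : z s(u, v) = 1 := by
    rw [hz, Pi.add_apply, sg_self]
    have : lc q.edges s(u, v) = 0 := by
      by_contra h; exact heT (q.edges_subset_edgeSet (lc_ne_zero_mem _ _ h))
    rw [this, add_zero]
  have hzev : EvenC z := evenC_of_path huv q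
  have hBd : Bd S0 = z := by
    have hev : EvenC (Bd S0 + z) := (evenC_Bd S0 fun t ht => (a1 t ht).2).add hzev
    have h0 : Bd S0 + z = 0 := by
      apply forest_even_zero T hT.isAcyclic _ hev
      intro f hf
      by_contra hfT
      apply hf
      have c1 : (Bd S0 + sg s(u, v)) f = 0 := by
        by_contra h; exact hfT (a3 f h)
      have c2 : lc q.edges f = 0 := by
        by_contra h; exact hfT (q.edges_subset_edgeSet (lc_ne_zero_mem _ _ h))
      rw [hz, ← add_assoc, Pi.add_apply, c1, c2, add_zero]
    calc Bd S0 = Bd S0 + (z + z) := by rw [chain_add_self, add_zero]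
      _ = (Bd S0 + z) + z := by abel
      _ = z := by rw [h0, zero_add]
  have hmin : MinEven z := by
    refine ⟨fun h => by rw [h] at hze; simp at hze, ?_⟩
    intro c hc hsub
    have hsub' : ∀ f, c f ≠ 0 → z f ≠ 0 := fun f hf => by
      have := hsub (by simpa using hf : f ∈ spt c); simpa using this
    rcases zmod2_cases (c s(u, v)) with h | h
    · left
      apply forest_even_zero T hT.isAcyclic _ hc
      intro f hf
      refine hzT f ?_ (hsub' f hf)
      rintro rfl; exact hf h
    · right
      have : c + z = 0 := by
        apply forest_even_zero T hT.isAcyclic _ (hc.add hzev)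
        intro f hf
        have hfe : f ≠ s(u, v) := by
          rintro rfl
          apply hf
          rw [Pi.add_apply, h, hze]; exact CharTwo.add_self_eq_zero _
        refine hzT f hfe ?_
        intro hzf
        apply hf
        rw [Pi.add_apply, hzf, add_zero]
        by_contra h'; exact hsub' f h' hzf
      calc c = c + (z + z) := by rw [chain_add_self, add_zero]
        _ = (c + z) + z := by abel
        _ = z := by rw [this, zero_add]
  obtain ⟨S, b1, b2, b3, b4⟩ := exists_irr G z hmin S0 a1 hBd
  refine ⟨S, b1, b4, ?_, b3.trans a2, ?_⟩
  · by_contra hle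
    apply h2
    refine ⟨S, b1, by omega, fun f hf => ?_⟩
    have hfe : f ≠ s(u, v) := by
      rintro rfl
      apply hf
      rw [Pi.add_apply, b2, hze, sg_self]; exact CharTwo.add_self_eq_zero _
    apply hzT f hfe
    rw [Pi.add_apply, b2] at hf
    simpa only [sg, if_neg hfe, add_zero] using hf
  · rw [b2]
    have : spt z ⊆ insert s(u, v) q.edges.toFinset := by
      intro f hf
      rw [mem_spt] at hf
      rw [mem_insert]
      by_cases hfe : f = s(u, v)
      · exact Or.inl hfe
      · right
        rw [hz, Pi.add_apply] at hf
        simp only [sg, if_neg hfe, zero_add] at hf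
        simpa using lc_ne_zero_mem _ _ hf
    calc (spt z).card ≤ _ := Finset.card_le_card this
      _ ≤ q.edges.toFinset.card + 1 := Finset.card_insert_le _ _
      _ ≤ q.length + 1 := by
        have := List.toFinset_card_le q.edges
        rw [SimpleGraph.Walk.length_edges] at this
        omega
      _ ≤ B := by rw [hq]; exact hdist u v

end fillings
end WSat

namespace WSat
open Finset
set_option linter.unusedSectionVars false

section code
variable {V : Type} [Fintype V] [DecidableEq V]

def tLv (u v : V) : BinaryTree V → List (Sym2 V)
  | .nil => [s(u, v)]
  | .node w l r => tLv u w l ++ tLv w v r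

def tTr (u v : V) : BinaryTree V → List (Finset V)
  | .nil => []
  | .node w l r => {u, v, w} :: (tTr u w l ++ tTr w v r)

def tIn : BinaryTree V → List V
  | .nil => []
  | .node w l r => tIn l ++ w :: tIn r

def prs (x : V) : List V → List (Sym2 V)
  | [] => []
  | y :: l => s(x, y) :: prs y l

lemma prs_append (x : V) (l : List V) (y : V) (m : List V) :
    prs x (l ++ y :: m) = prs x (l ++ [y]) ++ prs y m := by
  induction l generalizing x with
  | nil => simp [prs]
  | cons a l ih => simp [prs, ih]

lemma tLv_eq (u v : V) (t : BinaryTree V) : tLv u v t = prs u (tIn t ++ [v]) := by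
  induction t generalizing u v with
  | nil => simp [tLv, tIn, prs]
  | node w l r ihl ihr =>
    simp only [tLv, tIn, ihl, ihr]
    rw [List.append_assoc, List.cons_append, prs_append u (tIn l) w (tIn r ++ [v])]

lemma tTr_length (u v : V) (t : BinaryTree V) : (tTr u v t).length = t.numNodes := by
  induction t generalizing u v with
  | nil => simp [tTr, BinaryTree.numNodes]
  | node w l r ihl ihr => simp [tTr, BinaryTree.numNodes, ihl, ihr]

lemma tIn_length (t : BinaryTree V) : (tIn t).length = t.numNodes := by
  induction t with
  | nil => simp [tIn, BinaryTree.numNodes]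
  | node w l r ihl ihr => simp [tIn, BinaryTree.numNodes, ihl, ihr]; omega

def shp : BinaryTree V → BinaryTree Unit
  | .nil => .nil
  | .node _ l r => .node () (shp l) (shp r)

lemma shp_numNodes (t : BinaryTree V) : (shp t).numNodes = t.numNodes := by
  induction t with
  | nil => simp [shp, BinaryTree.numNodes]
  | node w l r ihl ihr => simp [shp, BinaryTree.numNodes, ihl, ihr]

lemma tree_inj (t t' : BinaryTree V) (h1 : shp t = shp t') (h2 : tIn t = tIn t') : t = t' := by
  induction t generalizing t' with
  | nil =>
    cases t' with
    | nil => rfl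
    | node w l r => simp [shp] at h1
  | node w l r ihl ihr =>
    cases t' with
    | nil => simp [shp] at h1
    | node w' l' r' =>
      simp only [shp, BinaryTree.node.injEq, true_and] at h1
      simp only [tIn] at h2
      have hlen : (tIn l).length = (tIn l').length := by
        rw [tIn_length, tIn_length, ← shp_numNodes l, ← shp_numNodes l', h1.1]
      obtain ⟨e1, e2⟩ := List.append_inj h2 hlen
      rw [List.cons.injEq] at e2
      rw [ihl l' h1.1 e1, ihr r' h1.2 e2.2, e2.1]

lemma card3 {u v w : V} (h : ({u, v, w} : Finset V).card = 3) : u ≠ v ∧ u ≠ w ∧ v ≠ w := by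
  refine ⟨?_, ?_, ?_⟩
  · rintro rfl
    have := Finset.card_le_two (a := u) (b := w)
    simp at h; omega
  · rintro rfl
    have := Finset.card_le_two (a := v) (b := u)
    rw [Finset.insert_comm, Finset.insert_eq_of_mem (a := u) (s := {u}) (by simp)] at h; omega
  · rintro rfl
    have := Finset.card_le_two (a := u) (b := v)
    simp at h; omega

lemma tele (u v : V) (t : BinaryTree V) (h : ∀ x ∈ tTr u v t, x.card = 3) :
    ((tTr u v t).map bd).sum = sg s(u, v) + lc (tLv u v t) := by
  induction t generalizing u v with
  | nil => simp [tTr, tLv, chain_add_self]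
  | node w l r ihl ihr =>
    simp only [tTr, List.mem_cons, List.mem_append, forall_eq_or_imp] at h
    obtain ⟨h1, h2⟩ := h
    obtain ⟨a, b, c⟩ := card3 h1
    simp only [tTr, tLv, List.map_cons, List.map_append, List.sum_cons, List.sum_append,
      ihl u w fun x hx => h2 x (Or.inl hx), ihr w v fun x hx => h2 x (Or.inr hx), lc_append,
      bd_triangle u v w a b c]
    have e1 := chain_add_self (sg s(u, w))
    have e2 := chain_add_self (sg s(w, v))
    calc _ = sg s(u, v) + (lc (tLv u w l) + lc (tLv w v r)) + (sg s(u, w) + sg s(u, w))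
          + (sg s(w, v) + sg s(w, v)) := by abel
      _ = _ := by rw [e1, e2, add_zero, add_zero]

lemma lv_edge (u v : V) (huv : u ≠ v) (t : BinaryTree V) (h : ∀ x ∈ tTr u v t, x.card = 3)
    (e : Sym2 V) (he : e ∈ tLv u v t) :
    e = s(u, v) ∧ t = .nil ∨ (¬ e.IsDiag ∧ ∃ x ∈ tTr u v t, e ∈ x.sym2) := by
  induction t generalizing u v with
  | nil => left; simpa [tLv] using he
  | node w l r ihl ihr =>
    right
    simp only [tTr, List.mem_cons, List.mem_append, forall_eq_or_imp] at h
    obtain ⟨h1, h2⟩ := h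
    obtain ⟨a, b, c⟩ := card3 h1
    simp only [tLv, List.mem_append] at he
    rcases he with he | he
    · rcases ihl u w b (fun x hx => h2 x (Or.inl hx)) he with h | ⟨h, x, hx, hex⟩
      · rw [h.1]
        exact ⟨by simpa using b, _, by simp [tTr]; left; rfl, by simp⟩
      · exact ⟨h, x, by simp [tTr, hx], hex⟩
    · rcases ihr w v c.symm (fun x hx => h2 x (Or.inr hx)) he with h | ⟨h, x, hx, hex⟩
      · rw [h.1]
        exact ⟨by simpa using c.symm, _, by simp [tTr]; left; rfl, by simp⟩
      · exact ⟨h, x, by simp [tTr, hx], hex⟩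

lemma attach (u v : V) (huv : u ≠ v) (t : BinaryTree V) (h : ∀ x ∈ tTr u v t, x.card = 3)
    (T0 : Finset V) (hT0 : T0.card = 3)
    (e : Sym2 V) (he : e ∈ tLv u v t) (heT : e ∈ T0.sym2) :
    ∃ t', (tTr u v t').Perm (T0 :: tTr u v t) := by
  induction t generalizing u v with
  | nil =>
    simp only [tLv, List.mem_singleton] at he
    subst he
    rw [Finset.mk_mem_sym2_iff] at heT
    have : ((T0.erase u).erase v).card = 1 := by
      rw [Finset.card_erase_of_mem (by simp [heT, huv.symm]), Finset.card_erase_of_mem heT.1, hT0]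
    obtain ⟨w, hw⟩ := Finset.card_eq_one.mp this
    refine ⟨.node w .nil .nil, ?_⟩
    have : ({u, v, w} : Finset V) = T0 := by
      rw [← hw, Finset.insert_erase (by simp [heT, huv.symm]), Finset.insert_erase heT.1]
    simp [tTr, this]
  | node w l r ihl ihr =>
    simp only [tTr, List.mem_cons, List.mem_append, forall_eq_or_imp] at h
    obtain ⟨h1, h2⟩ := h
    obtain ⟨a, b, c⟩ := card3 h1
    simp only [tLv, List.mem_append] at he
    rcases he with he | he
    · obtain ⟨l', hl'⟩ := ihl u w b (fun x hx => h2 x (Or.inl hx)) he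
      refine ⟨.node w l' r, ?_⟩
      simp only [tTr]
      refine ((hl'.append_right _).cons _).trans ?_
      rw [List.cons_append]
      exact List.Perm.swap _ _ _
    · obtain ⟨r', hr'⟩ := ihr w v c.symm (fun x hx => h2 x (Or.inr hx)) he
      refine ⟨.node w l r', ?_⟩
      simp only [tTr]
      refine ((hr'.append_left _).cons _).trans ?_
      refine (List.perm_middle.cons _).trans ?_
      exact List.Perm.swap _ _ _

lemma Bd_toFinset (l : List (Finset V)) (h : l.Nodup) : Bd l.toFinset = (l.map bd).sum := by
  unfold Bd
  rw [List.sum_toFinset _ h]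

lemma exists_code (S : Finset (Finset V)) (hS : Irr S) (u v : V)
    (he : s(u, v) ∈ spt (Bd S)) :
    ∃ t : BinaryTree V, (tTr u v t).Nodup ∧ (tTr u v t).toFinset = S := by
  classical
  have hev := evenC_Bd S hS.1
  have huv : u ≠ v := by
    rintro rfl
    rw [mem_spt] at he
    exact he (hev.1 u)
  let P : ℕ → Prop := fun k => ∃ t : BinaryTree V, (tTr u v t).Nodup ∧ (∀ x ∈ tTr u v t, x ∈ S) ∧
    (tTr u v t).length = k
  have hP0 : P 0 := ⟨.nil, by simp [tTr], by simp [tTr], by simp [tTr]⟩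
  have hbound : ∀ k, P k → k ≤ S.card := by
    rintro k ⟨t, h1, h2, h3⟩
    rw [← h3, ← List.toFinset_card_of_nodup h1]
    apply Finset.card_le_card
    intro x hx
    exact h2 x (by simpa using hx)
  obtain ⟨t, h1, h2, h3⟩ : P (Nat.findGreatest P S.card) := Nat.findGreatest_spec (Nat.zero_le _) hP0
  refine ⟨t, h1, ?_⟩
  have hc3 : ∀ x ∈ tTr u v t, x.card = 3 := fun x hx => hS.1 x (h2 x hx)
  set S1 := (tTr u v t).toFinset with hS1
  have hsub : S1 ⊆ S := fun x hx => h2 x (by simpa [hS1] using hx)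
  have stuck : ∀ T0 ∈ S, T0 ∉ S1 → ∀ e ∈ tLv u v t, e ∉ T0.sym2 := by
    intro T0 hT0 hT01 e he heT
    obtain ⟨t', ht'⟩ := attach u v huv t hc3 T0 (hS.1 T0 hT0) e he heT
    have hP : P ((tTr u v t').length) := by
      refine ⟨t', ?_, ?_, rfl⟩
      · rw [ht'.nodup_iff, List.nodup_cons]
        exact ⟨by simpa [hS1] using hT01, h1⟩
      · intro x hx
        rw [ht'.mem_iff, List.mem_cons] at hx
        rcases hx with rfl | hx
        · exact hT0
        · exact h2 x hx
    have := Nat.le_findGreatest (hbound _ hP) hP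
    rw [ht'.length_eq, List.length_cons] at this
    omega
  have hBd1 : Bd S1 = sg s(u, v) + lc (tLv u v t) := by
    rw [hS1, Bd_toFinset _ h1, tele u v t hc3]
  have hspt : spt (Bd S1) ⊆ spt (Bd S) := by
    intro f hf
    by_cases hfl : f ∈ tLv u v t
    · have : Bd S f = Bd S1 f := by
        unfold Bd
        rw [← Finset.sum_sdiff hsub, Pi.add_apply]
        have : (∑ x ∈ S \ S1, bd x) f = 0 := by
          rw [Finset.sum_apply]
          apply Finset.sum_eq_zero
          intro x hx
          rw [mem_sdiff] at hx
          simp [bd, stuck x hx.1 hx.2 f hfl]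
        rw [this, zero_add]
      rw [mem_spt] at hf ⊢
      rwa [this]
    · rw [mem_spt, hBd1, Pi.add_apply] at hf
      have : lc (tLv u v t) f = 0 := by
        by_contra h; exact hfl (lc_ne_zero_mem _ _ h)
      rw [this, add_zero] at hf
      have : f = s(u, v) := by
        by_contra h; simp [sg, h] at hf
      rw [this]; exact he
  rcases hS.2.2 S1 hsub hspt with h | h
  · exfalso
    have hnil : t = .nil := by
      cases t with
      | nil => rfl
      | node w l r => simp [hS1, tTr] at h
    rw [mem_spt] at he
    apply he
    unfold Bd
    rw [Finset.sum_apply]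
    apply Finset.sum_eq_zero
    intro x hx
    have := stuck x hx (by simp [h]) s(u, v) (by simp [hnil, tLv])
    simp [bd, this]
  · exact h

end code
end WSat

namespace WSat
open Finset
set_option linter.unusedSectionVars false

section walk
variable {V : Type} [Fintype V] [DecidableEq V]

noncomputable def stepw (a d p : ℝ) (S : Finset V) (c : Sym2 V → ZMod 2) (x y : V) : ℝ :=
  if y ∉ S then a else if (∀ z, c s(x, z) ≠ 0 ↔ z = y) then d else p

noncomputable def wt (a d p : ℝ) (S : Finset V) (c : Sym2 V → ZMod 2) (x : V) : List V → ℝ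
  | [] => 1
  | y :: l => stepw a d p S c x y * wt a d p (insert y S) (c + sg s(x, y)) y l

def RR (w0 : V) (c : Sym2 V → ZMod 2) (x : V) : Finset V :=
  univ.filter fun v => v = w0 ∨ v = x ∨ ∃ w, c s(v, w) ≠ 0

lemma mem_RR (w0 : V) (c : Sym2 V → ZMod 2) (x v : V) :
    v ∈ RR w0 c x ↔ v = w0 ∨ v = x ∨ ∃ w, c s(v, w) ≠ 0 := by simp [RR]

lemma spt_add_sg_open (c : Sym2 V → ZMod 2) (e : Sym2 V) (h : c e = 0) :
    (spt (c + sg e)).card = (spt c).card + 1 := by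
  have : spt (c + sg e) = insert e (spt c) := by
    ext f
    simp only [mem_spt, mem_insert, Pi.add_apply, sg]
    by_cases hf : f = e
    · subst hf; simp [h]
    · simp [hf]
  rw [this, Finset.card_insert_of_notMem (by simp [h])]

lemma spt_add_sg_close (c : Sym2 V → ZMod 2) (e : Sym2 V) (h : c e ≠ 0) :
    (spt (c + sg e)).card + 1 = (spt c).card := by
  have h2 : (c + sg e) e = 0 := by
    rw [Pi.add_apply, zmod2_ne _ h, sg_self]; exact CharTwo.add_self_eq_zero _
  rw [← spt_add_sg_open (c + sg e) e h2, add_assoc, chain_add_self, add_zero]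

lemma add_sg_ne (c : Sym2 V → ZMod 2) (e f : Sym2 V) (h : f ≠ e) : (c + sg e) f = c f := by
  simp [sg, h]

lemma RR_step (w0 x y v : V) (c : Sym2 V → ZMod 2) (hv : v ∈ RR w0 c x) (hvx : v ≠ x) :
    v ∈ RR w0 (c + sg s(x, y)) y := by
  rw [mem_RR] at hv ⊢
  rcases hv with h | h | ⟨w, h⟩
  · exact Or.inl h
  · exact absurd h hvx
  · by_cases hvy : v = y
    · exact Or.inr (Or.inl hvy)
    · right; right
      refine ⟨w, ?_⟩
      rw [add_sg_ne]
      · exact h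
      · rw [ne_eq, Sym2.eq_iff]
        rintro (⟨h1, _⟩ | ⟨h1, _⟩)
        · exact hvx h1
        · exact hvy h1

lemma acc (a d p : ℝ) (w0 : V) (l : List V) : ∀ (S : Finset V) (c : Sym2 V → ZMod 2) (x : V),
    w0 ∈ S → x ∈ S → (∀ f, c f ≠ 0 → f ∈ S.sym2) → (∀ e ∈ prs x l, ¬ e.IsDiag) →
    ∃ N D Y Z : ℕ, ∃ F : Finset (Sym2 V),
      wt a d p S c x l = a ^ N * d ^ D * p ^ (Y + Z) ∧ l.length = N + D + Y + Z ∧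
      (spt (c + lc (prs x l))).card + D + Z = (spt c).card + N + Y ∧
      (spt (c + lc (prs x l))).card + (RR w0 c x).card + Z ≤
        (spt c).card + (RR w0 (c + lc (prs x l)) (l.getLastD x)).card + Y ∧
      F.card = N ∧ F ⊆ (prs x l).toFinset ∧ (∀ f ∈ F, f ∉ S.sym2) ∧
      (∀ c', EvenC c' → (∀ f, c' f ≠ 0 → f ∈ F ∨ f ∈ S.sym2) → ∀ f ∈ F, c' f = 0) := by
  induction l with
  | nil =>
    intro S c x hw hx hc _
    refine ⟨0, 0, 0, 0, ∅, ?_⟩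
    simp [wt, prs]
  | cons y l ih =>
    intro S c x hw hx hc hne
    have hxy : x ≠ y := by
      have := hne s(x, y) (by simp [prs])
      simpa using this
    obtain ⟨N, D, Y, Z, F, i1, i2, i3, i4, i5, i6, i7, i8⟩ :=
      ih (insert y S) (c + sg s(x, y)) y (by simp [hw]) (by simp) (by
        intro f hf
        by_cases hfe : f = s(x, y)
        · rw [hfe]; simp [hx]
        · rw [add_sg_ne _ _ _ hfe] at hf
          exact Finset.sym2_mono (Finset.subset_insert y S) (hc f hf)) (by
        intro e he; exact hne e (by simp [prs, he]))
    have hcf : c + lc (prs x (y :: l)) = c + sg s(x, y) + lc (prs y l) := by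
      simp only [prs, lc_cons]; rw [add_assoc]
    rw [hcf, List.getLastD_cons]
    have hFsub : F ⊆ (prs x (y :: l)).toFinset := by
      intro f hf
      have := i6 hf
      simp only [prs, List.toFinset_cons, mem_insert]
      exact Or.inr this
    have hFS : ∀ f ∈ F, f ∉ S.sym2 := fun f hf h =>
      i7 f hf (Finset.sym2_mono (Finset.subset_insert y S) h)
    have hF8 : ∀ c', EvenC c' → (∀ f, c' f ≠ 0 → f ∈ F ∨ f ∈ S.sym2) → ∀ f ∈ F, c' f = 0 := by
      intro c' hc' hs
      apply i8 c' hc'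
      intro f hf
      rcases hs f hf with h | h
      · exact Or.inl h
      · exact Or.inr (Finset.sym2_mono (Finset.subset_insert y S) h)
    by_cases hy : y ∉ S
    · -- new vertex
      have hce : c s(x, y) = 0 := by
        by_contra h
        have := hc _ h
        rw [Finset.mk_mem_sym2_iff] at this
        exact hy this.2
      have hcard := spt_add_sg_open c _ hce
      have hRR : (RR w0 c x).card + 1 ≤ (RR w0 (c + sg s(x, y)) y).card := by
        have hynot : y ∉ RR w0 c x := by
          rw [mem_RR]
          rintro (h | h | ⟨w, h⟩)
          · exact hy (h ▸ hw)
          · exact hxy h.symm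
          · have := hc _ h
            rw [Finset.mk_mem_sym2_iff] at this
            exact hy this.1
        rw [← Finset.card_insert_of_notMem hynot]
        apply Finset.card_le_card
        intro v hv
        rw [mem_insert] at hv
        by_cases hvx : v = x
        · rw [mem_RR]; right; right
          refine ⟨y, ?_⟩
          rw [hvx, Pi.add_apply, hce, sg_self]; decide
        · rcases hv with rfl | hv
          · rw [mem_RR]; right; left; rfl
          · exact RR_step _ _ _ _ _ hv hvx
      have hnotF : s(x, y) ∉ F := fun h => i7 _ h (by simp [hx])
      refine ⟨N + 1, D, Y, Z, insert s(x, y) F, ?_, ?_, ?_, ?_, ?_, ?_, ?_, ?_⟩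
      · simp only [wt, stepw, if_pos hy, i1]; ring
      · simp only [List.length_cons, i2]; omega
      · omega
      · omega
      · rw [Finset.card_insert_of_notMem hnotF, i5]
      · intro f hf
        rw [mem_insert] at hf
        rcases hf with rfl | hf
        · simp [prs]
        · exact hFsub hf
      · intro f hf
        rw [mem_insert] at hf
        rcases hf with rfl | hf
        · simp [hy]
        · exact hFS f hf
      · intro c' hc' hs
        have hzF : ∀ f ∈ F, c' f = 0 := by
          apply i8 c' hc'
          intro f hf
          rcases hs f hf with h | h
          · rw [mem_insert] at h
            rcases h with rfl | h
            · right; simp [hx]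
            · exact Or.inl h
          · exact Or.inr (Finset.sym2_mono (Finset.subset_insert y S) h)
        intro f hf
        rw [mem_insert] at hf
        rcases hf with rfl | hf
        · have hsum := hc'.2 y
          rw [Finset.sum_eq_single x] at hsum
          · rw [Sym2.eq_swap]; exact hsum
          · intro w _ hwx
            by_contra hne'
            rcases hs _ hne' with h | h
            · rw [mem_insert] at h
              rcases h with h | h
              · rw [Sym2.eq_iff] at h
                rcases h with ⟨h1, _⟩ | ⟨_, h1⟩
                · exact hxy h1.symm
                · exact hwx h1
              · exact hne' (hzF _ h)
            · rw [Finset.mk_mem_sym2_iff] at h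
              exact hy h.1
          · simp
        · exact hzF f hf
    · have hyS : y ∈ S := not_not.mp hy
      by_cases hD : ∀ z, c s(x, z) ≠ 0 ↔ z = y
      · have hce : c s(x, y) ≠ 0 := (hD y).mpr rfl
        have hcard := spt_add_sg_close c _ hce
        have hRR : (RR w0 c x).card ≤ (RR w0 (c + sg s(x, y)) y).card + 1 := by
          refine le_trans (Finset.card_le_card (t := insert x (RR w0 (c + sg s(x, y)) y)) ?_)
            (Finset.card_insert_le _ _)
          intro v hv
          rw [mem_insert]
          by_cases hvx : v = x
          · exact Or.inl hvx
          · exact Or.inr (RR_step _ _ _ _ _ hv hvx)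
        refine ⟨N, D + 1, Y, Z, F, ?_, ?_, ?_, ?_, i5, hFsub, hFS, hF8⟩
        · simp only [wt, stepw, if_neg hy, if_pos hD, i1]; ring
        · simp only [List.length_cons, i2]; omega
        · omega
        · omega
      · by_cases hce : c s(x, y) = 0
        · have hcard := spt_add_sg_open c _ hce
          have hRR : (RR w0 c x).card ≤ (RR w0 (c + sg s(x, y)) y).card := by
            apply Finset.card_le_card
            intro v hv
            by_cases hvx : v = x
            · rw [mem_RR]; right; right
              refine ⟨y, ?_⟩
              rw [hvx, Pi.add_apply, hce, sg_self]; decide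
            · exact RR_step _ _ _ _ _ hv hvx
          refine ⟨N, D, Y + 1, Z, F, ?_, ?_, ?_, ?_, i5, hFsub, hFS, hF8⟩
          · simp only [wt, stepw, if_neg hy, if_neg hD, i1]; ring
          · simp only [List.length_cons, i2]; omega
          · omega
          · omega
        · have hcard := spt_add_sg_close c _ hce
          obtain ⟨z, hz1, hz2⟩ : ∃ z, c s(x, z) ≠ 0 ∧ z ≠ y := by
            by_contra hcon
            push Not at hcon
            exact hD fun z => ⟨hcon z, fun h => h ▸ hce⟩
          have hRR : (RR w0 c x).card ≤ (RR w0 (c + sg s(x, y)) y).card := by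
            apply Finset.card_le_card
            intro v hv
            by_cases hvx : v = x
            · rw [mem_RR]; right; right
              refine ⟨z, ?_⟩
              rw [hvx, add_sg_ne]
              · exact hz1
              · rw [ne_eq, Sym2.eq_iff]
                rintro (⟨_, h⟩ | ⟨h, _⟩)
                · exact hz2 h
                · exact hxy h
            · exact RR_step _ _ _ _ _ hv hvx
          refine ⟨N, D, Y, Z + 1, F, ?_, ?_, ?_, ?_, i5, hFsub, hFS, hF8⟩
          · simp only [wt, stepw, if_neg hy, if_neg hD, i1]; ring
          · simp only [List.length_cons, i2]; omega
          · omega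
          · omega

/-- vertices of a chain -/
def vx (z : Sym2 V → ZMod 2) : Finset V := univ.filter fun v => ∃ w, z s(v, w) ≠ 0

lemma even_deg (z : Sym2 V → ZMod 2) (hz : EvenC z) (v : V) (hv : ∃ w, z s(v, w) ≠ 0) :
    2 ≤ (univ.filter fun w => z s(v, w) ≠ 0).card := by
  have h1 := hz.2 v
  rw [← Finset.sum_filter_ne_zero] at h1
  rw [Finset.sum_congr rfl (fun w hw => zmod2_ne _ (mem_filter.mp hw).2)] at h1
  rw [Finset.sum_const, nsmul_eq_mul, mul_one, ZMod.natCast_eq_zero_iff] at h1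
  have h2 : 0 < (univ.filter fun w => z s(v, w) ≠ 0).card := by
    obtain ⟨w, hw⟩ := hv
    exact Finset.card_pos.mpr ⟨w, by simp [hw]⟩
  exact Nat.le_of_dvd h2 h1

lemma vx_card_le (z : Sym2 V → ZMod 2) (hz : EvenC z) : (vx z).card ≤ (spt z).card := by
  let Q : Finset (V × V) := univ.filter fun q => z s(q.1, q.2) ≠ 0
  have h1 : Q.card ≤ 2 * (spt z).card := by
    apply Finset.card_le_mul_card_image_of_maps_to (f := fun q : V × V => s(q.1, q.2))
    · intro q hq
      simpa [Q] using hq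
    · intro e he
      induction e using Sym2.ind with
      | _ a b =>
      refine le_trans (Finset.card_le_card (t := {(a, b), (b, a)}) ?_) Finset.card_le_two
      rintro ⟨q1, q2⟩ hq
      simp only [mem_filter, Sym2.eq_iff] at hq
      simp only [mem_insert, mem_singleton, Prod.mk.injEq]
      exact hq.2
  have h2 : (vx z).card * 2 ≤ Q.card := by
    have : Q = univ.biUnion fun v => (univ.filter fun w => z s(v, w) ≠ 0).image fun w => (v, w) := by
      ext ⟨a, b⟩
      simp only [Q, mem_filter, mem_univ, true_and, mem_biUnion, mem_image, Prod.mk.injEq]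
      constructor
      · intro h; exact ⟨a, b, h, rfl, rfl⟩
      · rintro ⟨a', b', h, rfl, rfl⟩; exact h
    rw [this, Finset.card_biUnion]
    · calc (vx z).card * 2 = ∑ v ∈ vx z, 2 := by rw [Finset.sum_const, smul_eq_mul]
        _ ≤ ∑ v ∈ vx z, ((univ.filter fun w => z s(v, w) ≠ 0).image fun w => (v, w)).card := by
            apply Finset.sum_le_sum
            intro v hv
            rw [Finset.card_image_of_injective _ (fun a b h => (Prod.mk.inj h).2)]
            apply even_deg z hz v
            simpa [vx] using hv
        _ ≤ _ := Finset.sum_le_sum_of_subset (Finset.subset_univ _)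
    · intro a _ b _ hab
      rw [Function.onFun, Finset.disjoint_left]
      rintro ⟨q1, q2⟩ h1 h2
      simp only [mem_image, Prod.mk.injEq] at h1 h2
      obtain ⟨_, _, e1, _⟩ := h1
      obtain ⟨_, _, e2, _⟩ := h2
      exact hab (e1.trans e2.symm)
  omega

/-- edges in a set of triangles -/
def EE (S : Finset (Finset V)) : Finset (Sym2 V) :=
  univ.filter fun e => ¬ e.IsDiag ∧ ∃ t ∈ S, e ∈ t.sym2

lemma Bd_spt_EE (S S' : Finset (Finset V)) (h : S' ⊆ S) (e : Sym2 V) (he : Bd S' e ≠ 0) :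
    e ∈ EE S := by
  unfold Bd at he
  rw [Finset.sum_apply] at he
  obtain ⟨t, ht, hte⟩ := Finset.exists_ne_zero_of_sum_ne_zero he
  have : e ∈ t.sym2 ∧ ¬ e.IsDiag := by
    by_contra hcon; simp only [bd, if_neg hcon, ne_eq, not_true_eq_false] at hte
  simp only [EE, mem_filter, mem_univ, true_and]
  exact ⟨this.2, t, h ht, this.1⟩

def ind (F : Finset (Sym2 V)) : Sym2 V → ZMod 2 := fun e => if e ∈ F then 1 else 0

/-- rank bound -/
lemma EE_card (S : Finset (Finset V)) (hS : Irr S) (F : Finset (Sym2 V)) (hF : F ⊆ EE S)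
    (hF0 : ∀ c', EvenC c' → (∀ f, c' f ≠ 0 → f ∈ F) → c' = 0) :
    S.card + F.card ≤ (EE S).card := by
  let φ : Finset (Finset V) × Finset (Sym2 V) → Finset (Sym2 V) :=
    fun q => spt (Bd q.1 + ind q.2)
  have hspt : ∀ c c' : Sym2 V → ZMod 2, spt c = spt c' → c = c' := by
    intro c c' h
    funext e
    have : c e ≠ 0 ↔ c' e ≠ 0 := by rw [← mem_spt, ← mem_spt, h]
    rcases zmod2_cases (c e) with h1 | h1 <;> rcases zmod2_cases (c' e) with h2 | h2 <;>
      simp_all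
  have hinj : Set.InjOn φ ↑(S.powerset ×ˢ F.powerset) := by
    rintro ⟨S1, F1⟩ h1 ⟨S2, F2⟩ h2 heq
    simp only [coe_product, coe_powerset, Set.mem_prod, Set.mem_preimage, Set.mem_powerset_iff,
      coe_subset] at h1 h2
    have hch := hspt _ _ heq
    simp only at hch
    have hz : Bd (symmDiff S1 S2) = ind F1 + ind F2 := by
      rw [Bd_symmDiff]
      calc Bd S1 + Bd S2 = (Bd S1 + ind F1) + ind F1 + Bd S2 := by
            rw [add_assoc (Bd S1), chain_add_self, add_zero]
        _ = (Bd S2 + Bd S2) + (ind F2 + ind F1) := by rw [hch]; abel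
        _ = _ := by rw [chain_add_self, zero_add, add_comm]
    have hsubS : symmDiff S1 S2 ⊆ S := by
      intro t ht
      rw [mem_symmDiff] at ht
      rcases ht with h | h
      · exact h1.1 h.1
      · exact h2.1 h.1
    have hev : EvenC (Bd (symmDiff S1 S2)) := evenC_Bd _ fun t ht => hS.1 t (hsubS ht)
    have h0 : Bd (symmDiff S1 S2) = 0 := by
      apply hF0 _ hev
      intro f hf
      rw [hz] at hf
      by_contra hfF
      apply hf
      have : f ∉ F1 := fun h => hfF (h1.2 h)
      have : f ∉ F2 := fun h => hfF (h2.2 h)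
      simp [ind, *]
    have hS12 : S1 = S2 := by
      rcases hS.2.2 _ hsubS (by rw [h0]; intro f hf; simp at hf) with h | h
      · exact symmDiff_eq_bot.mp h
      · exfalso
        obtain ⟨e, he⟩ := hS.2.1
        rw [← h, h0] at he
        simp at he
    have hF12 : F1 = F2 := by
      rw [h0] at hz
      ext f
      have := congrFun hz f
      simp only [Pi.zero_apply, Pi.add_apply, ind] at this
      by_cases a : f ∈ F1 <;> by_cases b : f ∈ F2 <;> simp only [a, b, if_true, if_false] at this ⊢
      · simp at this
      · simp at this
    rw [hS12, hF12]
  have hmaps : ∀ q ∈ S.powerset ×ˢ F.powerset, φ q ∈ (EE S).powerset := by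
    rintro ⟨S1, F1⟩ h
    simp only [mem_product, mem_powerset] at h
    rw [mem_powerset]
    intro e he
    rw [mem_spt] at he
    by_cases h1 : Bd S1 e = 0
    · rw [Pi.add_apply, h1, zero_add] at he
      have : e ∈ F1 := by
        by_contra h'; simp [ind, h'] at he
      exact hF (h.2 this)
    · exact Bd_spt_EE S S1 h.1 e h1
  have := Finset.card_le_card_of_injOn φ hmaps hinj
  rw [card_product, card_powerset, card_powerset, card_powerset, ← pow_add] at this
  exact (Nat.pow_le_pow_iff_right (by norm_num)).mp this

end walk
end WSat

namespace WSat
open Finset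
set_option linter.unusedSectionVars false

section mainlemma
variable {V : Type} [Fintype V] [DecidableEq V]

lemma weight_arith (p s : ℝ) (hp : 0 < p) (hps : p ≤ s) (hp1 : p ≤ 1) (E b A N D Y Z : ℕ)
    (h1 : A + N ≤ E) (h2 : A + 1 = N + D + Y + Z) (h3 : b + D + Z = N + Y + 1) (h4 : Z ≤ Y) :
    p ^ E * (p / s) ^ b * s ≤ (p ^ 3 / s) ^ N * s ^ D * p ^ (Y + Z) := by
  have hs : 0 < s := lt_of_lt_of_le hp hps
  rw [div_pow, div_pow]
  rw [show p ^ E * (p ^ b / s ^ b) * s = p ^ (E + b) * s / s ^ b by rw [pow_add]; ring,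
    show (p ^ 3) ^ N / s ^ N * s ^ D * p ^ (Y + Z) = p ^ (3 * N + Y + Z) * s ^ D / s ^ N by
      rw [add_assoc, pow_add _ (3 * N), pow_mul]; ring,
    div_le_div_iff₀ (by positivity) (by positivity)]
  obtain ⟨k, rfl⟩ := Nat.exists_eq_add_of_le h4
  calc p ^ (E + b) * s * s ^ N ≤ p ^ (3 * N + 2 * (Z + k)) * s * s ^ N := by
        gcongr ?_ * s * s ^ N
        exact pow_le_pow_of_le_one hp.le hp1 (by omega)
    _ = p ^ (3 * N + (Z + k) + Z) * (p ^ k * s ^ (N + 1)) := by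
        rw [show 3 * N + 2 * (Z + k) = (3 * N + (Z + k) + Z) + k by ring, pow_add, pow_succ]; ring
    _ ≤ p ^ (3 * N + (Z + k) + Z) * (s ^ k * s ^ (N + 1)) := by gcongr
    _ = p ^ (3 * N + (Z + k) + Z) * s ^ (D + b) := by
        rw [← pow_add]; congr 2; omega
    _ = _ := by rw [pow_add s]; ring

lemma code_weight (p s : ℝ) (hp : 0 < p) (hps : p ≤ s) (hp1 : p ≤ 1)
    (S : Finset (Finset V)) (hS : Irr S) (u v : V)
    (he : s(u, v) ∈ spt (Bd S)) (t : BinaryTree V) (ht1 : (tTr u v t).Nodup)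
    (ht2 : (tTr u v t).toFinset = S) :
    p ^ (EE S).card * (p / s) ^ (spt (Bd S)).card * s ≤
      wt (p ^ 3 / s) s p {u} 0 u (tIn t ++ [v]) := by
  have hev := evenC_Bd S hS.1
  rw [mem_spt] at he
  have huv : u ≠ v := by
    rintro rfl
    exact he (hev.1 u)
  have hc3 : ∀ x ∈ tTr u v t, x.card = 3 := fun x hx => hS.1 x (by rw [← ht2]; simpa using hx)
  have htn : t ≠ .nil := by
    rintro rfl
    obtain ⟨e, he⟩ := hS.2.1
    rw [← ht2] at he
    simp [tTr, Bd] at he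
  have hlv : ∀ e ∈ tLv u v t, e ∈ EE S := by
    intro e he
    rcases lv_edge u v huv t hc3 e he with h | ⟨h, x, hx, hex⟩
    · exact absurd h.2 htn
    · simp only [EE, mem_filter, mem_univ, true_and]
      exact ⟨h, x, by rw [← ht2]; simpa using hx, hex⟩
  have hBd : Bd S = sg s(u, v) + lc (tLv u v t) := by
    rw [← ht2, Bd_toFinset _ ht1, tele u v t hc3]
  have hlc : lc (tLv u v t) = Bd S + sg s(u, v) := by
    rw [hBd]
    calc _ = lc (tLv u v t) + (sg s(u, v) + sg s(u, v)) := by rw [chain_add_self, add_zero]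
      _ = _ := by abel
  obtain ⟨N, D, Y, Z, F, i1, i2, i3, i4, i5, i6, i7, i8⟩ :=
    acc (p ^ 3 / s) s p u (tIn t ++ [v]) {u} 0 u (by simp) (by simp) (by simp) (by
      intro e he
      rw [← tLv_eq] at he
      have := hlv e he
      simp only [EE, mem_filter, mem_univ, true_and] at this
      exact this.1)
  rw [i1]
  rw [← tLv_eq, zero_add, hlc] at i3 i4
  have hcl := spt_add_sg_close (Bd S) s(u, v) he
  have h0 : (spt (0 : Sym2 V → ZMod 2)).card = 0 := by
    rw [Finset.card_eq_zero]; ext f; simp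
  have hRR0 : (RR u (0 : Sym2 V → ZMod 2) u).card = 1 := by
    rw [Finset.card_eq_one]; exact ⟨u, by ext f; simp [RR]⟩
  have hlast : (tIn t ++ [v]).getLastD u = v := by
    simp [List.getLastD_eq_getLast?]
  have hRf : (RR u (Bd S + sg s(u, v)) v).card ≤ (spt (Bd S)).card := by
    refine le_trans (Finset.card_le_card ?_) (vx_card_le _ hev)
    intro x hx
    rw [mem_RR] at hx
    simp only [vx, mem_filter, mem_univ, true_and]
    rcases hx with rfl | rfl | ⟨w, hw⟩
    · exact ⟨v, he⟩
    · exact ⟨u, by rwa [Sym2.eq_swap]⟩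
    · by_cases h : s(x, w) = s(u, v)
      · exact ⟨w, by rwa [h]⟩
      · exact ⟨w, by rwa [add_sg_ne _ _ _ h] at hw⟩
  rw [hlast, h0, hRR0] at i4
  rw [h0] at i3
  have hlen : (tIn t ++ [v]).length = S.card + 1 := by
    rw [List.length_append, tIn_length, List.length_singleton, ← ht2,
      List.toFinset_card_of_nodup ht1, tTr_length]
  rw [hlen] at i2
  have hE : S.card + F.card ≤ (EE S).card := by
    apply EE_card S hS
    · intro f hf
      have := i6 hf
      rw [← tLv_eq] at this
      exact hlv f (by simpa using this)
    · intro c' hc' hs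
      have := i8 c' hc' (fun f hf => Or.inl (hs f hf))
      funext f
      by_contra hf
      exact hf (this f (hs f hf))
  rw [i5] at hE
  exact weight_arith p s hp hps hp1 _ _ S.card N D Y Z hE i2 (by omega) (by omega)

/-- all words of a given length -/
def words (V : Type) [Fintype V] [DecidableEq V] : ℕ → Finset (List V)
  | 0 => {[]}
  | k + 1 => (univ ×ˢ words V k).image fun q : V × List V => q.1 :: q.2

lemma mem_words (k : ℕ) (l : List V) : l ∈ words V k ↔ l.length = k := by
  induction k generalizing l with
  | zero => simp [words]
  | succ k ih =>
    cases l with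
    | nil => simp [words]
    | cons y l => simp [words, ih]

lemma sum_words (k : ℕ) (f : List V → ℝ) :
    ∑ l ∈ words V (k + 1), f l = ∑ y, ∑ l ∈ words V k, f (y :: l) := by
  rw [words, Finset.sum_image, Finset.sum_product]
  rintro ⟨a, b⟩ _ ⟨c, d⟩ _ h
  simpa using h

lemma card_words (k : ℕ) : (words V k).card = (Fintype.card V) ^ k := by
  induction k with
  | zero => simp [words]
  | succ k ih =>
    rw [words, Finset.card_image_of_injective, Finset.card_product, ih, Finset.card_univ]
    · ring
    · rintro ⟨a, b⟩ ⟨c, d⟩ h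
      simpa using h

lemma stepw_sum (a d p : ℝ) (ha : 0 ≤ a) (hd : 0 ≤ d) (hp : 0 ≤ p) (S : Finset V)
    (c : Sym2 V → ZMod 2) (x : V) :
    ∑ y, stepw a d p S c x y ≤ Fintype.card V * a + d + S.card * p := by
  have h1 : ∀ y, stepw a d p S c x y ≤
      a + (if (∀ z, c s(x, z) ≠ 0 ↔ z = y) then d else 0) + (if y ∈ S then p else 0) := by
    intro y
    unfold stepw
    split_ifs <;> linarith
  refine (Finset.sum_le_sum fun y _ => h1 y).trans ?_
  rw [Finset.sum_add_distrib, Finset.sum_add_distrib]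
  have e1 : ∑ y : V, (if y ∈ S then p else 0) = S.card * p := by
    rw [Finset.sum_ite_mem, Finset.univ_inter, Finset.sum_const, nsmul_eq_mul]
  have e2 : ∑ y : V, (if (∀ z, c s(x, z) ≠ 0 ↔ z = y) then d else 0) ≤ d := by
    by_cases h : ∃ y0, ∀ z, c s(x, z) ≠ 0 ↔ z = y0
    · obtain ⟨y0, h0⟩ := h
      have : ∀ y, (if (∀ z, c s(x, z) ≠ 0 ↔ z = y) then d else 0) = if y = y0 then d else 0 := by
        intro y
        congr 1
        apply propext
        constructor
        · intro h
          exact (h0 y).mp ((h y).mpr rfl)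
        · rintro rfl; exact h0
      simp only [this]
      simp
    · push Not at h
      have : ∀ y, (if (∀ z, c s(x, z) ≠ 0 ↔ z = y) then d else 0) = 0 := by
        intro y
        rw [if_neg]
        intro h'
        obtain ⟨z, hz⟩ := h y
        have := h' z
        tauto
      simp only [this]
      simpa using hd
  rw [e1, Finset.sum_const, nsmul_eq_mul, Finset.card_univ]
  linarith

lemma stepw_nonneg (a d p : ℝ) (ha : 0 ≤ a) (hd : 0 ≤ d) (hp : 0 ≤ p) (S : Finset V)
    (c : Sym2 V → ZMod 2) (x y : V) : 0 ≤ stepw a d p S c x y := by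
  unfold stepw; split_ifs <;> assumption

lemma wt_nonneg (a d p : ℝ) (ha : 0 ≤ a) (hd : 0 ≤ d) (hp : 0 ≤ p) (l : List V) :
    ∀ (S : Finset V) (c : Sym2 V → ZMod 2) (x : V), 0 ≤ wt a d p S c x l := by
  induction l with
  | nil => intro S c x; simp [wt]
  | cons y l ih =>
    intro S c x
    exact mul_nonneg (stepw_nonneg a d p ha hd hp _ _ _ _) (ih _ _ _)

lemma wt_sum (a d p : ℝ) (ha : 0 ≤ a) (hd : 0 ≤ d) (hp : 0 ≤ p) (M k : ℕ) :
    ∀ (S : Finset V) (c : Sym2 V → ZMod 2) (x : V), S.card + k ≤ M →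
    ∑ l ∈ words V k, wt a d p S c x l ≤ (Fintype.card V * a + d + M * p) ^ k := by
  induction k with
  | zero => intro S c x _; simp [words, wt]
  | succ k ih =>
    intro S c x hM
    rw [sum_words]
    have hK : 0 ≤ (Fintype.card V * a + d + M * p) ^ k := by positivity
    calc _ = ∑ y, stepw a d p S c x y * ∑ l ∈ words V k, wt a d p (insert y S) (c + sg s(x, y)) y l := by
          simp only [wt, Finset.mul_sum]
      _ ≤ ∑ y, stepw a d p S c x y * (Fintype.card V * a + d + M * p) ^ k := by
          apply Finset.sum_le_sum
          intro y _
          apply mul_le_mul_of_nonneg_left _ (stepw_nonneg a d p ha hd hp _ _ _ _)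
          apply ih
          have := Finset.card_insert_le y S
          omega
      _ = (∑ y, stepw a d p S c x y) * (Fintype.card V * a + d + M * p) ^ k := by
          rw [Finset.sum_mul]
      _ ≤ (Fintype.card V * a + d + M * p) * (Fintype.card V * a + d + M * p) ^ k := by
          gcongr
          refine (stepw_sum a d p ha hd hp S c x).trans ?_
          have : (S.card : ℝ) ≤ M := by exact_mod_cast (by omega : S.card ≤ M)
          gcongr
      _ = _ := by ring

lemma main_sum (p s : ℝ) (hp : 0 < p) (hps : p ≤ s) (hp1 : p ≤ 1) (A M : ℕ) (hM : A + 2 ≤ M)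
    (FF : Finset (Finset (Finset V))) (hF : ∀ S ∈ FF, Irr S ∧ S.card = A) :
    ∑ S ∈ FF, p ^ (EE S).card * (p / s) ^ (spt (Bd S)).card * s ≤
      4 ^ A * Fintype.card V * (Fintype.card V * (p ^ 3 / s) + s + M * p) ^ (A + 1) := by
  classical
  have hs : 0 < s := lt_of_lt_of_le hp hps
  have hex : ∀ S ∈ FF, ∃ u v : V, ∃ t : BinaryTree V,
      s(u, v) ∈ spt (Bd S) ∧ (tTr u v t).Nodup ∧ (tTr u v t).toFinset = S := by
    intro S hSF
    have hS := (hF S hSF).1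
    obtain ⟨e, he⟩ := hS.2.1
    induction e using Sym2.ind with
    | _ u v =>
    obtain ⟨t, h1, h2⟩ := exists_code S hS u v he
    exact ⟨u, v, t, he, h1, h2⟩
  choose cu cv ct hc1 hc2 hc3 using hex
  let ψ : {S // S ∈ FF} → BinaryTree Unit × V × List V := fun S =>
    (shp (ct S.1 S.2), cu S.1 S.2, tIn (ct S.1 S.2) ++ [cv S.1 S.2])
  let g : BinaryTree Unit × V × List V → ℝ := fun q =>
    wt (p ^ 3 / s) s p {q.2.1} 0 q.2.1 q.2.2
  have hg : ∀ q, 0 ≤ g q := fun q =>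
    wt_nonneg _ _ _ (by positivity) hs.le hp.le _ _ _ _
  let I : Finset (BinaryTree Unit × V × List V) :=
    BinaryTree.treesOfNumNodesEq A ×ˢ (univ ×ˢ words V (A + 1))
  have hnum : ∀ S : {S // S ∈ FF}, (ct S.1 S.2).numNodes = A := by
    intro S
    rw [← tTr_length (cu S.1 S.2) (cv S.1 S.2), ← List.toFinset_card_of_nodup (hc2 S.1 S.2),
      hc3 S.1 S.2]
    exact (hF S.1 S.2).2
  have hmaps : ∀ S ∈ FF.attach, ψ S ∈ I := by
    intro S _
    simp only [I, ψ, mem_product, mem_univ, true_and, BinaryTree.mem_treesOfNumNodesEq, mem_words]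
    refine ⟨by rw [shp_numNodes]; exact hnum S, ?_⟩
    rw [List.length_append, tIn_length, hnum S]; rfl
  have hinj : Set.InjOn ψ ↑(FF.attach) := by
    intro S _ S' _ h
    simp only [ψ, Prod.mk.injEq] at h
    obtain ⟨h1, h2, h3⟩ := h
    obtain ⟨h4, h5⟩ := List.append_inj' h3 rfl
    have h6 := tree_inj _ _ h1 h4
    have h7 : cv S.1 S.2 = cv S'.1 S'.2 := by simpa using h5
    apply Subtype.ext
    rw [← hc3 S.1 S.2, ← hc3 S'.1 S'.2, h6, h7, h2]
  calc _ = ∑ S ∈ FF.attach, p ^ (EE S.1).card * (p / s) ^ (spt (Bd S.1)).card * s := by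
        rw [Finset.sum_attach FF (fun S => p ^ (EE S).card * (p / s) ^ (spt (Bd S)).card * s)]
    _ ≤ ∑ S ∈ FF.attach, g (ψ S) := by
        apply Finset.sum_le_sum
        intro S _
        exact code_weight p s hp hps hp1 S.1 (hF S.1 S.2).1 _ _ (hc1 S.1 S.2) _ (hc2 S.1 S.2)
          (hc3 S.1 S.2)
    _ = ∑ q ∈ FF.attach.image ψ, g q := by rw [Finset.sum_image hinj]
    _ ≤ ∑ q ∈ I, g q := by
        apply Finset.sum_le_sum_of_subset_of_nonneg
        · intro q hq
          obtain ⟨S, hS, rfl⟩ := mem_image.mp hq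
          exact hmaps S hS
        · intro q _ _; exact hg q
    _ = (BinaryTree.treesOfNumNodesEq A).card •
          ∑ u : V, ∑ l ∈ words V (A + 1), wt (p ^ 3 / s) s p {u} 0 u l := by
        simp only [I, g, Finset.sum_product, Finset.sum_const]
    _ ≤ (BinaryTree.treesOfNumNodesEq A).card •
          ∑ u : V, (Fintype.card V * (p ^ 3 / s) + s + M * p) ^ (A + 1) := by
        apply nsmul_le_nsmul_right
        apply Finset.sum_le_sum
        intro u _
        apply wt_sum _ _ _ (by positivity) hs.le hp.le
        simp; omega
    _ ≤ _ := by
        rw [Finset.sum_const, nsmul_eq_mul, nsmul_eq_mul, Finset.card_univ, mul_assoc]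
        gcongr
        rw [BinaryTree.treesOfNumNodesEq_card_eq_catalan, catalan_eq_centralBinom_div]
        have h1 : Nat.centralBinom A / (A + 1) ≤ 4 ^ A :=
          (Nat.div_le_self _ _).trans (Nat.centralBinom_le_four_pow A)
        exact_mod_cast h1

end mainlemma
end WSat

namespace WSat
open Finset
set_option linter.unusedSectionVars false

section gnp

open scoped Classical in
noncomputable def Ex (n : ℕ) (p : ℝ) (f : SimpleGraph (Fin n) → ℝ) : ℝ :=
  ∑ G : SimpleGraph (Fin n), p ^ edgeCard G * (1 - p) ^ (n.choose 2 - edgeCard G) * f G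

open scoped Classical in
lemma gnpProb_eq (n : ℕ) (p : ℝ) (A : Set (SimpleGraph (Fin n))) :
    gnpProb n p A = Ex n p (fun G => if G ∈ A then 1 else 0) := by
  unfold gnpProb Ex
  apply Finset.sum_congr rfl
  intro G _
  by_cases h : G ∈ A <;> simp [h]

def E0 (n : ℕ) : Finset (Sym2 (Fin n)) := univ.filter fun e => ¬ e.IsDiag

lemma card_E0 (n : ℕ) : (E0 n).card = n.choose 2 := by
  have := Sym2.card_subtype_not_diag (α := Fin n)
  rw [Fintype.card_fin] at this
  rw [← this, E0, Fintype.card_subtype]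

open scoped Classical in
noncomputable def gE {n : ℕ} (G : SimpleGraph (Fin n)) : Finset (Sym2 (Fin n)) :=
  univ.filter fun e => e ∈ G.edgeSet

lemma mem_gE {n : ℕ} (G : SimpleGraph (Fin n)) (e) : e ∈ gE G ↔ e ∈ G.edgeSet := by simp [gE]

lemma gE_card {n : ℕ} (G : SimpleGraph (Fin n)) : edgeCard G = (gE G).card := by
  classical
  unfold edgeCard gE
  rw [Nat.card_eq_fintype_card, Fintype.card_subtype]

lemma gE_sub {n : ℕ} (G : SimpleGraph (Fin n)) : gE G ⊆ E0 n := by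
  intro e he
  rw [mem_gE] at he
  simp only [E0, mem_filter, mem_univ, true_and]
  exact G.not_isDiag_of_mem_edgeSet he

open scoped Classical in
lemma sum_graphs (n : ℕ) (f : Finset (Sym2 (Fin n)) → ℝ) :
    ∑ G : SimpleGraph (Fin n), f (gE G) = ∑ s ∈ (E0 n).powerset, f s := by
  apply Finset.sum_bij (fun G _ => gE G)
  · intro G _; rw [mem_powerset]; exact gE_sub G
  · intro G _ G' _ h
    rw [← SimpleGraph.edgeSet_inj]
    ext e
    rw [← mem_gE, ← mem_gE, h]
  · intro s hs
    rw [mem_powerset] at hs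
    refine ⟨SimpleGraph.fromEdgeSet ↑s, mem_univ _, ?_⟩
    ext e
    rw [mem_gE, SimpleGraph.edgeSet_fromEdgeSet]
    simp only [Set.mem_sdiff, mem_coe]
    constructor
    · intro h; exact h.1
    · intro h
      refine ⟨h, ?_⟩
      have := hs h
      simp only [E0, mem_filter, mem_univ, true_and] at this
      exact this
  · intro G _; rfl

open scoped Classical in
lemma gen_super (n : ℕ) (x y : ℝ) (S : Finset (Sym2 (Fin n))) (hS : S ⊆ E0 n) :
    ∑ G : SimpleGraph (Fin n), x ^ edgeCard G * y ^ (n.choose 2 - edgeCard G) *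
      (if S ⊆ gE G then 1 else 0) = x ^ S.card * (x + y) ^ (n.choose 2 - S.card) := by
  simp only [gE_card]
  rw [sum_graphs n (fun s => x ^ s.card * y ^ (n.choose 2 - s.card) * if S ⊆ s then 1 else 0)]
  have : ∀ s ∈ (E0 n).powerset, x ^ s.card * y ^ (n.choose 2 - s.card) * (if S ⊆ s then (1 : ℝ) else 0)
      = if S ⊆ s then x ^ s.card * y ^ (n.choose 2 - s.card) else 0 := by
    intro s _; split_ifs <;> simp
  rw [Finset.sum_congr rfl this, ← Finset.sum_filter]
  have h2 : (n.choose 2 - S.card) = (E0 n \ S).card := by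
    rw [Finset.card_sdiff_of_subset hS, card_E0]
  rw [h2, ← Finset.sum_pow_mul_eq_add_pow, Finset.mul_sum]
  symm
  apply Finset.sum_bij (fun s _ => S ∪ s)
  · intro s hs
    rw [mem_powerset] at hs
    simp only [mem_filter, mem_powerset]
    exact ⟨union_subset hS (hs.trans sdiff_subset), subset_union_left⟩
  · intro s hs s' hs' h
    rw [mem_powerset] at hs hs'
    ext e
    by_cases heS : e ∈ S
    · constructor
      · intro h; exact absurd heS (mem_sdiff.mp (hs h)).2
      · intro h; exact absurd heS (mem_sdiff.mp (hs' h)).2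
    · have := congrArg (fun t => e ∈ t) h
      simpa [heS] using this
  · intro s hs
    simp only [mem_filter, mem_powerset] at hs
    refine ⟨s \ S, by rw [mem_powerset]; exact sdiff_subset_sdiff hs.1 (le_refl _), ?_⟩
    rw [union_sdiff_of_subset hs.2]
  · intro s hs
    rw [mem_powerset] at hs
    have hd : Disjoint S s := by
      rw [Finset.disjoint_left]
      intro e he h; exact (mem_sdiff.mp (hs h)).2 he
    rw [card_union_of_disjoint hd, pow_add, Finset.card_sdiff_of_subset hS, card_E0, mul_assoc]
    congr 3
    omega

lemma Ex_add (n : ℕ) (p : ℝ) (f g : SimpleGraph (Fin n) → ℝ) :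
    Ex n p (fun G => f G + g G) = Ex n p f + Ex n p g := by
  simp only [Ex, mul_add, Finset.sum_add_distrib]

lemma Ex_sum {ι : Type} (n : ℕ) (p : ℝ) (s : Finset ι) (f : ι → SimpleGraph (Fin n) → ℝ) :
    Ex n p (fun G => ∑ i ∈ s, f i G) = ∑ i ∈ s, Ex n p (f i) := by
  simp only [Ex, Finset.mul_sum]
  rw [Finset.sum_comm]

lemma Ex_const_mul (n : ℕ) (p : ℝ) (c : ℝ) (f : SimpleGraph (Fin n) → ℝ) :
    Ex n p (fun G => c * f G) = c * Ex n p f := by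
  simp only [Ex, Finset.mul_sum]
  apply Finset.sum_congr rfl
  intro G _; ring

lemma Ex_mono (n : ℕ) (p : ℝ) (hp0 : 0 ≤ p) (hp1 : p ≤ 1) (f g : SimpleGraph (Fin n) → ℝ)
    (h : ∀ G, f G ≤ g G) : Ex n p f ≤ Ex n p g := by
  unfold Ex
  apply Finset.sum_le_sum
  intro G _
  have : 0 ≤ 1 - p := by linarith
  exact mul_le_mul_of_nonneg_left (h G) (by positivity)

open scoped Classical in
lemma Ex_super (n : ℕ) (p : ℝ) (S : Finset (Sym2 (Fin n))) (hS : S ⊆ E0 n) :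
    Ex n p (fun G => if S ⊆ gE G then 1 else 0) = p ^ S.card := by
  have := gen_super n p (1 - p) S hS
  rw [add_sub_cancel, one_pow, mul_one] at this
  exact this

lemma Ex_one (n : ℕ) (p : ℝ) : Ex n p (fun _ => 1) = 1 := by
  have := Ex_super n p ∅ (by simp)
  simpa using this

open scoped Classical in
lemma Ex_half (n : ℕ) (p : ℝ) : Ex n p (fun G => (1 / 2) ^ edgeCard G) =
    (1 - p / 2) ^ (n.choose 2) := by
  have := gen_super n (p / 2) (1 - p) ∅ (by simp)
  simp only [Finset.empty_subset, if_true, mul_one, Finset.card_empty, pow_zero, one_mul,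
    Nat.sub_zero] at this
  rw [show p / 2 + (1 - p) = 1 - p / 2 by ring] at this
  rw [← this]
  unfold Ex
  apply Finset.sum_congr rfl
  intro G _
  simp only [div_pow, one_pow]; ring

lemma prob_le (n : ℕ) (p : ℝ) (hp0 : 0 ≤ p) (hp1 : p ≤ 1) (A : Set (SimpleGraph (Fin n)))
    (f : SimpleGraph (Fin n) → ℝ) (hf0 : ∀ G, 0 ≤ f G) (hf1 : ∀ G ∈ A, 1 ≤ f G) :
    gnpProb n p A ≤ Ex n p f := by
  classical
  rw [gnpProb_eq]
  apply Ex_mono n p hp0 hp1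
  intro G
  split_ifs with h
  · exact hf1 G h
  · exact hf0 G

lemma prob_nonneg (n : ℕ) (p : ℝ) (hp0 : 0 ≤ p) (hp1 : p ≤ 1) (A : Set (SimpleGraph (Fin n))) :
    0 ≤ gnpProb n p A := by
  unfold gnpProb
  apply Finset.sum_nonneg
  intro G _
  have : 0 ≤ 1 - p := by linarith
  split_ifs
  · positivity
  · exact le_refl _

lemma prob_union (n : ℕ) (p : ℝ) (hp0 : 0 ≤ p) (hp1 : p ≤ 1) (A B C : Set (SimpleGraph (Fin n)))
    (h : ∀ G ∈ A, G ∈ B ∨ G ∈ C) : gnpProb n p A ≤ gnpProb n p B + gnpProb n p C := by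
  classical
  rw [gnpProb_eq n p B, gnpProb_eq n p C, ← Ex_add]
  apply prob_le n p hp0 hp1
  · intro G; split_ifs <;> norm_num
  · intro G hG
    rcases h G hG with h | h
    · rw [if_pos h]; split_ifs <;> norm_num
    · rw [if_pos h]; split_ifs <;> norm_num

lemma prob_compl (n : ℕ) (p : ℝ) (A : Set (SimpleGraph (Fin n))) :
    gnpProb n p {G | ¬ G ∈ A} = 1 - gnpProb n p A := by
  classical
  rw [gnpProb_eq, gnpProb_eq, eq_sub_iff_add_eq, ← Ex_add]
  refine Eq.trans ?_ (Ex_one n p)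
  congr 1
  funext G
  by_cases h : G ∈ A <;> simp [h]

/-- few edges is unlikely -/
lemma prob_few (n : ℕ) (p : ℝ) (hp0 : 0 ≤ p) (hp1 : p ≤ 1) :
    gnpProb n p {G | (edgeCard G : ℝ) ≤ n.choose 2 * p / 2} ≤
      Real.exp (-(n.choose 2 * p / 2) * (1 - Real.log 2)) := by
  set m := (n.choose 2 : ℝ) * p / 2 with hm
  have h1 : gnpProb n p {G | (edgeCard G : ℝ) ≤ m} ≤
      Ex n p (fun G => Real.exp (m * Real.log 2) * (1 / 2) ^ edgeCard G) := by
    apply prob_le n p hp0 hp1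
    · intro G; positivity
    · intro G hG
      simp only [Set.mem_ofPred_eq] at hG
      have : (1 / 2 : ℝ) ^ edgeCard G = Real.exp (-(edgeCard G * Real.log 2)) := by
        rw [← Real.log_pow, Real.exp_neg, Real.exp_log (by positivity), one_div, inv_pow]
      rw [this, ← Real.exp_add]
      apply Real.one_le_exp
      have := mul_le_mul_of_nonneg_right hG (Real.log_pos one_lt_two).le
      linarith
  refine h1.trans ?_
  rw [Ex_const_mul, Ex_half]
  have h2 : (1 - p / 2) ^ (n.choose 2) ≤ Real.exp (-m) := by
    calc (1 - p / 2) ^ (n.choose 2) ≤ (Real.exp (-(p / 2))) ^ (n.choose 2) := by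
          apply pow_le_pow_left₀ (by linarith)
          have := Real.add_one_le_exp (-(p / 2))
          linarith
      _ = _ := by rw [← Real.exp_nat_mul]; congr 1; rw [hm]; ring
  calc _ ≤ Real.exp (m * Real.log 2) * Real.exp (-m) := by gcongr
    _ = _ := by rw [← Real.exp_add]; congr 1; ring

end gnp
end WSat

namespace WSat
open Finset
set_option linter.unusedSectionVars false

section cycles
variable {V : Type} [Fintype V] [DecidableEq V]

/-- the `i`-th edge of a closed sequence -/
def ce (x : Fin 8 → V) (i : Fin 8) : Sym2 V := s(x i, x (i + 1))

def cyc (x : Fin 8 → V) : Sym2 V → ZMod 2 := ∑ i, sg (ce x i)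

lemma fin8_ne1 (i : Fin 8) : i ≠ i + 1 := by revert i; decide
lemma fin8_ne2 (i : Fin 8) : i ≠ i + 1 + 1 := by revert i; decide

lemma ce_inj (x : Fin 8 → V) (hx : Function.Injective x) : Function.Injective (ce x) := by
  intro i j h
  unfold ce at h
  rw [Sym2.eq_iff] at h
  rcases h with ⟨h, _⟩ | ⟨h1, h2⟩
  · exact hx h
  · have a := hx h1
    have b := hx h2
    rw [a] at b
    exact absurd b.symm (fin8_ne2 j)

lemma cyc_apply (x : Fin 8 → V) (hx : Function.Injective x) (i : Fin 8) : cyc x (ce x i) = 1 := by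
  unfold cyc
  rw [Finset.sum_apply, Finset.sum_eq_single i]
  · exact sg_self _
  · intro j _ hj
    simp only [sg]
    rw [if_neg]
    intro h; exact hj (ce_inj x hx h).symm
  · simp

lemma cyc_apply_ne (x : Fin 8 → V) (e : Sym2 V) (h : cyc x e ≠ 0) : ∃ i, e = ce x i := by
  unfold cyc at h
  rw [Finset.sum_apply] at h
  obtain ⟨i, _, hi⟩ := Finset.exists_ne_zero_of_sum_ne_zero h
  refine ⟨i, ?_⟩
  by_contra hne
  simp [sg, hne] at hi

lemma spt_cyc (x : Fin 8 → V) (hx : Function.Injective x) : spt (cyc x) = univ.image (ce x) := by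
  ext e
  rw [mem_spt, mem_image]
  constructor
  · intro h
    obtain ⟨i, rfl⟩ := cyc_apply_ne x e h
    exact ⟨i, mem_univ _, rfl⟩
  · rintro ⟨i, _, rfl⟩
    rw [cyc_apply x hx]; decide

lemma spt_cyc_card (x : Fin 8 → V) (hx : Function.Injective x) : (spt (cyc x)).card = 8 := by
  rw [spt_cyc x hx, Finset.card_image_of_injective _ (ce_inj x hx)]; simp

lemma evenC_cyc (x : Fin 8 → V) (hx : ∀ i, x i ≠ x (i + 1)) : EvenC (cyc x) := by
  constructor
  · intro v
    unfold cyc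
    rw [Finset.sum_apply]
    exact Finset.sum_eq_zero fun i _ => sg_diag _ _ (hx i) v
  · intro v
    unfold cyc
    simp only [Finset.sum_apply]
    rw [Finset.sum_comm]
    simp only [ce, sg_star _ _ (hx _)]
    rw [Finset.sum_add_distrib]
    have : ∑ i : Fin 8, (if v = x (i + 1) then (1 : ZMod 2) else 0) =
        ∑ i : Fin 8, (if v = x i then (1 : ZMod 2) else 0) :=
      Equiv.sum_comp (Equiv.addRight (1 : Fin 8)) (fun i => if v = x i then (1 : ZMod 2) else 0)
    rw [this]
    exact CharTwo.add_self_eq_zero _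

lemma minEven_cyc (x : Fin 8 → V) (hx : Function.Injective x) : MinEven (cyc x) := by
  have hxn : ∀ i, x i ≠ x (i + 1) := fun i h => fin8_ne1 i (hx h)
  refine ⟨fun h => ?_, ?_⟩
  · have := cyc_apply x hx 0
    rw [h] at this
    simp at this
  intro c hc hsub
  have hsub' : ∀ e, c e ≠ 0 → ∃ i, e = ce x i := by
    intro e he
    have := hsub (by simpa using he : e ∈ spt c)
    rw [mem_spt] at this
    exact cyc_apply_ne x e this
  have hstep : ∀ i, c (ce x i) = c (ce x (i + 1)) := by
    intro i
    have h := hc.2 (x (i + 1))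
    have hne : x i ≠ x (i + 1 + 1) := fun h => fin8_ne2 i (hx h)
    rw [← Finset.sum_subset (Finset.subset_univ {x i, x (i + 1 + 1)}), Finset.sum_pair hne] at h
    · have h1 : s(x (i + 1), x i) = ce x i := by rw [Sym2.eq_swap]; rfl
      have h2 : s(x (i + 1), x (i + 1 + 1)) = ce x (i + 1) := rfl
      rw [h1, h2] at h
      exact CharTwo.add_eq_zero.mp h
    · intro w _ hw
      by_contra hcw
      obtain ⟨j, hj⟩ := hsub' _ hcw
      unfold ce at hj
      rw [Sym2.eq_iff] at hj
      apply hw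
      rw [mem_insert, mem_singleton]
      rcases hj with ⟨h1, h2⟩ | ⟨h1, h2⟩
      · right
        rw [h2, hx h1]
      · left
        have := hx h1
        rw [h2, add_right_cancel this]
  have hall : ∀ i, c (ce x i) = c (ce x 0) := by
    have e0 := hstep 0
    have e1 := hstep 1
    have e2 := hstep 2
    have e3 := hstep 3
    have e4 := hstep 4
    have e5 := hstep 5
    have e6 := hstep 6
    norm_num at e0 e1 e2 e3 e4 e5 e6
    simp only [Fin.reduceAdd] at e0 e1 e2 e3 e4 e5 e6
    intro i
    fin_cases i
    · rfl
    · exact e0.symm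
    · exact (e0.trans e1).symm
    · exact (e0.trans (e1.trans e2)).symm
    · exact (e0.trans (e1.trans (e2.trans e3))).symm
    · exact (e0.trans (e1.trans (e2.trans (e3.trans e4)))).symm
    · exact (e0.trans (e1.trans (e2.trans (e3.trans (e4.trans e5))))).symm
    · exact (e0.trans (e1.trans (e2.trans (e3.trans (e4.trans (e5.trans e6)))))).symm
  rcases zmod2_cases (c (ce x 0)) with h | h
  · left
    funext e
    by_contra he
    obtain ⟨i, rfl⟩ := hsub' e he
    exact he ((hall i).trans h)
  · right
    funext e
    by_cases he : ∃ i, e = ce x i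
    · obtain ⟨i, rfl⟩ := he
      rw [hall i, h, cyc_apply x hx]
    · have h1 : c e = 0 := by
        by_contra h'; exact he (hsub' e h')
      have h2 : cyc x e = 0 := by
        by_contra h'; exact he (cyc_apply_ne x e h')
      rw [h1, h2]

lemma combine {ι : Type} [DecidableEq ι] (G : SimpleGraph V) (I : Finset ι)
    (S : ι → Finset (Finset V)) (L : ℕ)
    (h1 : ∀ i ∈ I, IsTri G (S i)) (h2 : ∀ i ∈ I, (S i).card ≤ L) :
    ∃ S', IsTri G S' ∧ S'.card ≤ I.card * L ∧ Bd S' = ∑ i ∈ I, Bd (S i) := by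
  induction I using Finset.induction_on with
  | empty => exact ⟨∅, by simp [IsTri], by simp, by simp [Bd_empty]⟩
  | insert a I ha ih =>
    obtain ⟨S', b1, b2, b3⟩ := ih (fun i hi => h1 i (by simp [hi])) (fun i hi => h2 i (by simp [hi]))
    refine ⟨symmDiff (S a) S', (h1 a (by simp)).symmDiff b1, ?_, ?_⟩
    · have := card_symmDiff_le (S a) S'
      have h3 := h2 a (by simp)
      rw [Finset.card_insert_of_notMem ha, add_mul]
      omega
    · rw [Bd_symmDiff, b3, Finset.sum_insert ha]

lemma cyc_fill (G T : SimpleGraph V) (hT : T.IsAcyclic) (L : ℕ)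
    (hfill : ∀ e ∈ G.edgeSet, Fill G T L e) (x : Fin 8 → V) (hx : Function.Injective x)
    (hG : ∀ i, G.Adj (x i) (x (i + 1))) :
    ∃ S, IsTri G S ∧ Irr S ∧ S.card ≤ 8 * L ∧ Bd S = cyc x := by
  choose S hS1 hS2 hS3 using fun i => hfill (ce x i) (hG i)
  obtain ⟨S', b1, b2, b3⟩ := combine G univ S L (fun i _ => hS1 i) (fun i _ => hS2 i)
  have hBd : Bd S' = cyc x := by
    have hz : Bd S' + cyc x = 0 := by
      apply forest_even_zero T hT
      · exact (evenC_Bd S' fun t ht => (b1 t ht).2).add (evenC_cyc x fun i => (hG i).ne)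
      · intro f hf
        rw [b3, cyc, ← Finset.sum_add_distrib, Finset.sum_apply] at hf
        obtain ⟨i, _, hi⟩ := Finset.exists_ne_zero_of_sum_ne_zero hf
        exact hS3 i f hi
    calc Bd S' = Bd S' + (cyc x + cyc x) := by rw [chain_add_self, add_zero]
      _ = (Bd S' + cyc x) + cyc x := by abel
      _ = _ := by rw [hz, zero_add]
  obtain ⟨S'', c1, c2, c3, c4⟩ := exists_irr G (cyc x) (minEven_cyc x hx) S' b1 hBd
  refine ⟨S'', c1, c4, ?_, c2⟩
  have : (univ : Finset (Fin 8)).card = 8 := by simp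
  rw [this] at b2
  omega

/-- number of sequences with given cycle chain -/
lemma card_cyc_fiber (z : Sym2 V → ZMod 2) (hz : EvenC z) (hz8 : (spt z).card = 8) :
    (univ.filter fun x : Fin 8 → V => Function.Injective x ∧ cyc x = z).card ≤ 8 ^ 8 := by
  have hsub : (univ.filter fun x : Fin 8 → V => Function.Injective x ∧ cyc x = z) ⊆
      Fintype.piFinset fun _ : Fin 8 => vx z := by
    intro x hx
    simp only [mem_filter, mem_univ, true_and] at hx
    rw [Fintype.mem_piFinset]
    intro i
    simp only [vx, mem_filter, mem_univ, true_and]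
    refine ⟨x (i + 1), ?_⟩
    have := cyc_apply x hx.1 i
    rw [hx.2] at this
    unfold ce at this
    rw [this]; decide
  refine (Finset.card_le_card hsub).trans ?_
  rw [Fintype.card_piFinset]
  simp only [Finset.prod_const, Finset.card_univ, Fintype.card_fin]
  have := vx_card_le z hz
  rw [hz8] at this
  exact Nat.pow_le_pow_left this 8

lemma verts_edges (y : ℕ → V) (k : ℕ) :
    ((range (k + 1)).image y).card ≤ ((range k).image fun j => s(y j, y (j + 1))).card + 1 := by
  induction k with
  | zero => simp
  | succ k ih =>
    rw [Finset.range_add_one (n := k + 1), Finset.image_insert]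
    by_cases h : y (k + 1) ∈ (range (k + 1)).image y
    · rw [Finset.insert_eq_of_mem h]
      refine ih.trans ?_
      gcongr
      exact Nat.le_succ k
    · have e1 : (range (k + 1)).image (fun j => s(y j, y (j + 1))) =
          insert s(y k, y (k + 1)) ((range k).image fun j => s(y j, y (j + 1))) := by
        rw [Finset.range_add_one, Finset.image_insert]
      rw [Finset.card_insert_of_notMem h, e1, Finset.card_insert_of_notMem]
      · omega
      · intro he
        obtain ⟨j, hj, hje⟩ := mem_image.mp he
        apply h
        rw [Sym2.eq_iff] at hje
        rw [mem_range] at hj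
        rcases hje with ⟨_, h2⟩ | ⟨h1, _⟩
        · exact mem_image.mpr ⟨j + 1, by simp; omega, h2⟩
        · exact mem_image.mpr ⟨j, by simp; omega, h1⟩

lemma fin8_succ (k : ℕ) : Fin.ofNat 8 (k + 1) = Fin.ofNat 8 k + 1 := by
  apply Fin.ext
  simp [Fin.ofNat, Fin.val_add]

lemma fin8_rot (i j : Fin 8) : ∃ k : ℕ, k < 8 ∧ i + 1 + Fin.ofNat 8 k = j := by
  revert i j; decide

lemma fin8_rot_ne (i : Fin 8) (k : ℕ) (hk : k < 7) : i + 1 + Fin.ofNat 8 k ≠ i := by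
  revert i; interval_cases k <;> decide

lemma deg_cases (x : Fin 8 → V) :
    (univ.image x).card ≤ (univ.image (ce x)).card ∨
    ((univ.image x).card ≤ (univ.image (ce x)).card + 1 ∧ (univ.image (ce x)).card ≤ 4) := by
  have him : ∀ i : Fin 8, (range (7 + 1)).image (fun k : ℕ => x (i + 1 + Fin.ofNat 8 k)) = univ.image x := by
    intro i
    ext v
    simp only [mem_image, mem_range, mem_univ, true_and]
    constructor
    · rintro ⟨k, _, rfl⟩; exact ⟨_, rfl⟩
    · rintro ⟨j, rfl⟩
      obtain ⟨k, hk, h⟩ := fin8_rot i j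
      exact ⟨k, hk, by rw [h]⟩
  have hed : ∀ (i : Fin 8) (k : ℕ),
      s(x (i + 1 + Fin.ofNat 8 k), x (i + 1 + Fin.ofNat 8 (k + 1))) = ce x (i + 1 + Fin.ofNat 8 k) := by
    intro i k
    unfold ce
    rw [fin8_succ, ← add_assoc]
  by_cases h : ∃ i, ∀ j, ce x j = ce x i → j = i
  · left
    obtain ⟨i, hi⟩ := h
    have h1 := verts_edges (fun k : ℕ => x (i + 1 + Fin.ofNat 8 k)) 7
    rw [him i] at h1
    refine h1.trans ?_
    have h2 : ((range 7).image fun j => s(x (i + 1 + Fin.ofNat 8 j), x (i + 1 + Fin.ofNat 8 (j + 1)))) ⊆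
        (univ.image (ce x)).erase (ce x i) := by
      intro e he
      obtain ⟨k, hk, rfl⟩ := mem_image.mp he
      rw [hed]
      rw [mem_erase]
      exact ⟨fun h => fin8_rot_ne i k (mem_range.mp hk) (hi _ h), mem_image.mpr ⟨_, mem_univ _, rfl⟩⟩
    have h3 := Finset.card_le_card h2
    rw [Finset.card_erase_of_mem (mem_image.mpr ⟨i, mem_univ _, rfl⟩)] at h3
    have : 0 < (univ.image (ce x)).card := Finset.card_pos.mpr ⟨_, mem_image.mpr ⟨i, mem_univ _, rfl⟩⟩
    omega
  · right
    push Not at h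
    constructor
    · have h1 := verts_edges (fun k : ℕ => x (0 + 1 + Fin.ofNat 8 k)) 7
      rw [him 0] at h1
      refine h1.trans ?_
      gcongr
      intro e he
      obtain ⟨k, hk, rfl⟩ := mem_image.mp he
      rw [hed]
      exact mem_image.mpr ⟨_, mem_univ _, rfl⟩
    · have h1 : ((univ.image (ce x)).card) * 2 ≤ (univ : Finset (Fin 8)).card := by
        rw [Finset.card_eq_sum_card_image (ce x) univ]
        rw [← smul_eq_mul, ← Finset.sum_const]
        apply Finset.sum_le_sum
        intro e he
        obtain ⟨i, _, rfl⟩ := mem_image.mp he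
        obtain ⟨j, hj1, hj2⟩ := h i
        have : ({i, j} : Finset (Fin 8)) ⊆ univ.filter fun a => ce x a = ce x i := by
          intro a ha
          rw [mem_insert, mem_singleton] at ha
          rcases ha with rfl | rfl
          · simp
          · simp [hj1]
        calc 2 = ({i, j} : Finset (Fin 8)).card := (Finset.card_pair (Ne.symm hj2)).symm
          _ ≤ _ := Finset.card_le_card this
      simp at h1
      omega

end cycles
end WSat

namespace WSat
open Finset
set_option linter.unusedSectionVars false

section homs
variable {V : Type} [Fintype V] [DecidableEq V]

lemma cs_sum (f : V → ℝ) : (∑ x, f x) ^ 2 ≤ Fintype.card V * ∑ x, f x ^ 2 := by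
  have := sq_sum_le_card_mul_sum_sq (s := (univ : Finset V)) (f := f)
  simpa using this

def tup : V × V × V × V × V × V × V × V → (Fin 8 → V) :=
  fun q => ![q.1, q.2.2.2.2.2.2.2, q.2.2.1, q.2.2.2.2.2.2.1, q.2.1, q.2.2.2.2.2.1, q.2.2.2.1,
    q.2.2.2.2.1]

lemma tup_bij : Function.Bijective (tup (V := V)) := by
  constructor
  · rintro ⟨a, b, c, d, e, f, g, h⟩ ⟨a', b', c', d', e', f', g', h'⟩ heq
    have h0 := congrFun heq 0
    have h1 := congrFun heq 1
    have h2 := congrFun heq 2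
    have h3 := congrFun heq 3
    have h4 := congrFun heq 4
    have h5 := congrFun heq 5
    have h6 := congrFun heq 6
    have h7 := congrFun heq 7
    simp [tup] at h0 h1 h2 h3 h4 h5 h6 h7
    subst h0 h1 h2 h3 h4 h5 h6 h7
    rfl
  · intro x
    refine ⟨(x 0, x 4, x 2, x 6, x 7, x 5, x 3, x 1), ?_⟩
    funext i
    fin_cases i <;> rfl

lemma hom_expand (a : V → V → ℝ) :
    ∑ x : Fin 8 → V, ∏ i, a (x i) (x (i + 1)) =
      ∑ x, ∑ z, (∑ y, (∑ i, a x i * a i y) * (∑ j, a y j * a j z)) *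
        (∑ w, (∑ k, a z k * a k w) * (∑ l, a w l * a l x)) := by
  rw [← Function.Bijective.sum_comp (tup_bij (V := V)) (fun x => ∏ i, a (x i) (x (i + 1)))]
  simp only [Fintype.sum_prod_type, Fin.prod_univ_eight]
  apply Finset.sum_congr rfl; intro x _
  apply Finset.sum_congr rfl; intro z _
  rw [Finset.sum_mul_sum]
  apply Finset.sum_congr rfl; intro y _
  apply Finset.sum_congr rfl; intro w _
  simp only [Finset.sum_mul_sum, Finset.sum_mul, Finset.mul_sum]
  apply Finset.sum_congr rfl; intro i _
  apply Finset.sum_congr rfl; intro j _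
  apply Finset.sum_congr rfl; intro k _
  apply Finset.sum_congr rfl; intro l _
  simp [tup]
  ring

lemma hom_lower (a : V → V → ℝ) (hsymm : ∀ x y, a x y = a y x) (hV : 0 < Fintype.card V) :
    ((∑ x, ∑ y, a x y) / Fintype.card V) ^ 8 ≤ ∑ x : Fin 8 → V, ∏ i, a (x i) (x (i + 1)) := by
  set n : ℝ := ((Fintype.card V : ℕ) : ℝ) with hn
  have hn0 : 0 < n := by rw [hn]; exact_mod_cast hV
  set b : V → V → ℝ := fun x y => ∑ i, a x i * a i y with hb
  set c : V → V → ℝ := fun x z => ∑ y, b x y * b y z with hc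
  have hbs : ∀ x y, b x y = b y x := by
    intro x y
    apply Finset.sum_congr rfl
    intro i _
    rw [hsymm x i, hsymm i y, mul_comm]
  have hcs : ∀ x y, c x y = c y x := by
    intro x y
    apply Finset.sum_congr rfl
    intro i _
    rw [hbs x i, hbs i y, mul_comm]
  have h1 : ∑ x : Fin 8 → V, ∏ i, a (x i) (x (i + 1)) = ∑ x, ∑ z, c x z ^ 2 := by
    rw [hom_expand]
    apply Finset.sum_congr rfl; intro x _
    apply Finset.sum_congr rfl; intro z _
    rw [sq]
    nth_rewrite 2 [hcs]
    rfl
  rw [h1]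
  set A := ∑ x, ∑ y, a x y with hA
  have hB : A ^ 2 ≤ n * ∑ x, ∑ y, b x y := by
    have : ∑ x, ∑ y, b x y = ∑ i, (∑ y, a i y) ^ 2 := by
      simp only [hb]
      calc _ = ∑ x, ∑ i, ∑ y, a x i * a i y := by
            apply Finset.sum_congr rfl; intro x _; rw [Finset.sum_comm]
        _ = ∑ i, ∑ x, ∑ y, a x i * a i y := by rw [Finset.sum_comm]
        _ = _ := by
          apply Finset.sum_congr rfl; intro i _
          rw [sq, Finset.sum_mul_sum]
          apply Finset.sum_congr rfl; intro x _
          apply Finset.sum_congr rfl; intro y _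
          rw [hsymm x i]
    rw [this]; exact cs_sum _
  have hC : (∑ x, ∑ y, b x y) ^ 2 ≤ n * ∑ x, ∑ y, c x y := by
    have : ∑ x, ∑ y, c x y = ∑ i, (∑ y, b i y) ^ 2 := by
      simp only [hc]
      calc _ = ∑ x, ∑ i, ∑ y, b x i * b i y := by
            apply Finset.sum_congr rfl; intro x _; rw [Finset.sum_comm]
        _ = ∑ i, ∑ x, ∑ y, b x i * b i y := by rw [Finset.sum_comm]
        _ = _ := by
          apply Finset.sum_congr rfl; intro i _
          rw [sq, Finset.sum_mul_sum]
          apply Finset.sum_congr rfl; intro x _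
          apply Finset.sum_congr rfl; intro y _
          rw [hbs x i]
    rw [this]; exact cs_sum _
  have hD : (∑ x, ∑ y, c x y) ^ 2 ≤ n ^ 2 * ∑ x, ∑ z, c x z ^ 2 := by
    calc (∑ x, ∑ y, c x y) ^ 2 ≤ n * ∑ x, (∑ y, c x y) ^ 2 := cs_sum _
      _ ≤ n * ∑ x, (n * ∑ y, c x y ^ 2) := by
        gcongr with x _
        exact cs_sum _
      _ = _ := by rw [← Finset.mul_sum]; ring
  rw [div_pow, div_le_iff₀ (by positivity)]
  set B := ∑ x, ∑ y, b x y
  set C := ∑ x, ∑ y, c x y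
  set D := ∑ x, ∑ z, c x z ^ 2
  have hA4 : A ^ 4 ≤ n ^ 3 * C := by
    calc A ^ 4 = (A ^ 2) ^ 2 := by ring
      _ ≤ (n * B) ^ 2 := by gcongr
      _ = n ^ 2 * B ^ 2 := by ring
      _ ≤ n ^ 2 * (n * C) := by gcongr
      _ = _ := by ring
  calc A ^ 8 = (A ^ 4) ^ 2 := by ring
    _ ≤ (n ^ 3 * C) ^ 2 := by gcongr
    _ = n ^ 6 * C ^ 2 := by ring
    _ ≤ n ^ 6 * (n ^ 2 * D) := by gcongr
    _ = _ := by ring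

open scoped Classical in
noncomputable def H8 (G : SimpleGraph V) : Finset (Fin 8 → V) :=
  univ.filter fun x => ∀ i, G.Adj (x i) (x (i + 1))

lemma mem_H8 (G : SimpleGraph V) (x) : x ∈ H8 G ↔ ∀ i, G.Adj (x i) (x (i + 1)) := by
  simp [H8]

lemma H8_lower (G : SimpleGraph V) (hV : 0 < Fintype.card V) :
    (2 * edgeCard G / Fintype.card V : ℝ) ^ 8 ≤ (H8 G).card := by
  classical
  have h := hom_lower (fun x y : V => if G.Adj x y then (1 : ℝ) else 0)
    (fun x y => by simp [G.adj_comm]) hV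
  have h1 : ∑ x, ∑ y, (if G.Adj x y then (1 : ℝ) else 0) = 2 * edgeCard G := by
    have h2 : ∀ x, ∑ y, (if G.Adj x y then (1 : ℝ) else 0) = G.degree x := by
      intro x
      rw [Finset.sum_boole, ← SimpleGraph.card_neighborFinset_eq_degree]
      congr 2
      ext y; simp
    simp only [h2]
    rw [← Nat.cast_sum, SimpleGraph.sum_degrees_eq_twice_card_edges]
    push_cast
    congr 2
    rw [edgeCard, Nat.card_eq_fintype_card, SimpleGraph.edgeFinset_card]
  rw [h1] at h
  refine h.trans (le_of_eq ?_)
  rw [H8, ← Finset.sum_boole]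
  apply Finset.sum_congr rfl
  intro x _
  rw [Finset.prod_boole]
  simp

end homs
end WSat

namespace WSat
open Finset
set_option linter.unusedSectionVars false

lemma EE_sub_E0 {n : ℕ} (S : Finset (Finset (Fin n))) : EE S ⊆ E0 n := by
  intro e he
  simp only [EE, mem_filter, mem_univ, true_and] at he
  simp only [E0, mem_filter, mem_univ, true_and]
  exact he.1

lemma EE_sub_gE {n : ℕ} (G : SimpleGraph (Fin n)) (S : Finset (Finset (Fin n))) (h : IsTri G S) :
    EE S ⊆ gE G := by
  intro e he
  simp only [EE, mem_filter, mem_univ, true_and] at he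
  obtain ⟨h1, t, ht, h2⟩ := he
  rw [mem_gE]
  induction e using Sym2.ind with
  | _ u v =>
  rw [Finset.mk_mem_sym2_iff] at h2
  exact (h t ht).isClique h2.1 h2.2 (by simpa using h1)

/-- parameters -/
structure Par (n : ℕ) (p s : ℝ) (M : ℕ) : Prop where
  hp : 0 < p
  hps : p ≤ s
  hp1 : p ≤ 1
  hK : n * (p ^ 3 / s) + s + M * p ≤ 9 / 4 * s
  hs : 9 * s ≤ 4 / 5

lemma Q1 {n : ℕ} {p s : ℝ} {M : ℕ} (P : Par n p s M) (A : ℕ) (hM : A + 2 ≤ M)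
    (FF : Finset (Finset (Finset (Fin n)))) (hF : ∀ S ∈ FF, Irr S ∧ S.card = A) :
    ∑ S ∈ FF, p ^ (EE S).card * (p / s) ^ (spt (Bd S)).card ≤ 9 / 4 * n * (4 / 5) ^ A := by
  have hs : 0 < s := lt_of_lt_of_le P.hp P.hps
  have hp := P.hp
  have h := main_sum p s P.hp P.hps P.hp1 A M hM FF hF
  rw [← Finset.sum_mul, Fintype.card_fin] at h
  set K := (n * (p ^ 3 / s) + s + M * p : ℝ) with hKdef
  have hK0 : 0 ≤ K := by positivity
  have hK := P.hK
  have hss := P.hs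
  have h4 : (4 * K) ^ A ≤ (4 / 5) ^ A := by
    apply pow_le_pow_left₀ (by positivity)
    rw [← hKdef] at hK
    linarith
  refine le_of_mul_le_mul_right (h.trans ?_) hs
  calc (4 : ℝ) ^ A * n * K ^ (A + 1) = n * ((4 * K) ^ A * K) := by rw [mul_pow]; ring
    _ ≤ n * ((4 / 5) ^ A * (9 / 4 * s)) := by gcongr
    _ = _ := by ring

lemma Q2 {n : ℕ} {p s : ℝ} {M : ℕ} (P : Par n p s M) (I : Finset ℕ) (hM : ∀ A ∈ I, A + 2 ≤ M)
    (FF : Finset (Finset (Finset (Fin n)))) (hF : ∀ S ∈ FF, Irr S ∧ S.card ∈ I) :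
    ∑ S ∈ FF, p ^ (EE S).card * (p / s) ^ (spt (Bd S)).card ≤
      9 / 4 * n * ∑ A ∈ I, (4 / 5 : ℝ) ^ A := by
  rw [← Finset.sum_fiberwise_of_maps_to (t := I) (g := fun S => S.card) (fun S hS => (hF S hS).2),
    Finset.mul_sum]
  apply Finset.sum_le_sum
  intro A hA
  apply Q1 P A (hM A hA)
  intro S hS
  rw [mem_filter] at hS
  exact ⟨(hF S hS.1).1, hS.2⟩

/-- the bad event -/
def Bad1 (n L B : ℕ) : Set (SimpleGraph (Fin n)) :=
  {G | ∃ S, IsTri G S ∧ Irr S ∧ L < S.card ∧ S.card ≤ 2 * L + 1 ∧ (spt (Bd S)).card ≤ B}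

lemma bad1_bound {n : ℕ} {p s : ℝ} {M : ℕ} (P : Par n p s M) (L B : ℕ) (hM : 2 * L + 3 ≤ M) :
    gnpProb n p (Bad1 n L B) ≤ (s / p) ^ B * (9 / 4 * n * ((L + 1) * (4 / 5 : ℝ) ^ L)) := by
  classical
  have hs : 0 < s := lt_of_lt_of_le P.hp P.hps
  have hp := P.hp
  set FF : Finset (Finset (Finset (Fin n))) := univ.filter fun S => Irr S ∧ L < S.card ∧
    S.card ≤ 2 * L + 1 ∧ (spt (Bd S)).card ≤ B with hFF
  have h1 := prob_le n p hp.le P.hp1 (Bad1 n L B)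
    (fun G => ∑ S ∈ FF, if EE S ⊆ gE G then (1 : ℝ) else 0)
    (fun G => Finset.sum_nonneg fun S _ => by split_ifs <;> norm_num)
    (by
      rintro G ⟨S, h1, h2, h3, h4, h5⟩
      have hS : S ∈ FF := by simp only [hFF, mem_filter, mem_univ, true_and]; exact ⟨h2, h3, h4, h5⟩
      have := Finset.single_le_sum (f := fun S => if EE S ⊆ gE G then (1 : ℝ) else 0)
        (fun S _ => by split_ifs <;> norm_num) hS
      simpa [EE_sub_gE G S h1] using this)
  refine h1.trans ?_
  rw [Ex_sum]
  have h2 : ∀ S ∈ FF, Ex n p (fun G => if EE S ⊆ gE G then (1 : ℝ) else 0) ≤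
      (s / p) ^ B * (p ^ (EE S).card * (p / s) ^ (spt (Bd S)).card) := by
    intro S hS
    simp only [hFF, mem_filter, mem_univ, true_and] at hS
    rw [Ex_super n p _ (EE_sub_E0 S)]
    have h3 : (p / s) ^ B ≤ (p / s) ^ (spt (Bd S)).card :=
      pow_le_pow_of_le_one (by positivity) (by rw [div_le_one hs]; exact P.hps) hS.2.2.2
    have h4 : (s / p) ^ B * (p / s) ^ B = 1 := by
      rw [← mul_pow, div_mul_div_cancel₀ hp.ne', div_self hs.ne', one_pow]
    calc p ^ (EE S).card = (s / p) ^ B * (p ^ (EE S).card * (p / s) ^ B) := by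
          rw [mul_comm (p ^ _), ← mul_assoc, h4, one_mul]
      _ ≤ _ := by gcongr
  refine (Finset.sum_le_sum h2).trans ?_
  rw [← Finset.mul_sum]
  gcongr
  refine (Q2 P (Ioc L (2 * L + 1)) (fun A hA => by rw [mem_Ioc] at hA; omega) FF ?_).trans ?_
  · intro S hS
    simp only [hFF, mem_filter, mem_univ, true_and] at hS
    exact ⟨hS.1, mem_Ioc.2 ⟨hS.2.1, hS.2.2.1⟩⟩
  · gcongr
    calc ∑ A ∈ Ioc L (2 * L + 1), (4 / 5 : ℝ) ^ A ≤ ∑ A ∈ Ioc L (2 * L + 1), (4 / 5 : ℝ) ^ L := by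
          apply Finset.sum_le_sum
          intro A hA
          rw [mem_Ioc] at hA
          exact pow_le_pow_of_le_one (by norm_num) (by norm_num) hA.1.le
      _ = _ := by
        rw [Finset.sum_const, Nat.card_Ioc, nsmul_eq_mul]
        congr 1
        rw [show 2 * L + 1 - L = L + 1 by omega]; push_cast; ring

/-- fillable injective cycles -/
def FillC {n : ℕ} (L : ℕ) (G : SimpleGraph (Fin n)) (x : Fin 8 → Fin n) : Prop :=
  Function.Injective x ∧ ∃ S, IsTri G S ∧ Irr S ∧ S.card ≤ 8 * L ∧ Bd S = cyc x

lemma sum_geom_le (k : ℕ) : ∑ A ∈ range k, (4 / 5 : ℝ) ^ A ≤ 5 := by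
  have h : ∀ k, ∑ A ∈ range k, (4 / 5 : ℝ) ^ A = 5 - 5 * (4 / 5) ^ k := by
    intro k
    induction k with
    | zero => simp
    | succ k ih => rw [Finset.sum_range_succ, ih]; ring
  rw [h]
  have : (0 : ℝ) ≤ (4 / 5) ^ k := by positivity
  linarith

open scoped Classical in
lemma fillC_bound {n : ℕ} {p s : ℝ} {M : ℕ} (P : Par n p s M) (L : ℕ) (hM : 8 * L + 2 ≤ M) :
    Ex n p (fun G => ((univ.filter fun x => FillC L G x).card : ℝ)) ≤
      8 ^ 8 * ((s / p) ^ 8 * (9 / 4 * n * 5)) := by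
  have hs : 0 < s := lt_of_lt_of_le P.hp P.hps
  have hp := P.hp
  set FF : Finset (Finset (Finset (Fin n))) := univ.filter fun S => Irr S ∧ S.card ≤ 8 * L ∧
    (spt (Bd S)).card = 8 ∧ EvenC (Bd S) with hFF
  have h1 : Ex n p (fun G => ((univ.filter fun x => FillC L G x).card : ℝ)) ≤
      Ex n p (fun G => ∑ S ∈ FF, 8 ^ 8 * (if EE S ⊆ gE G then (1 : ℝ) else 0)) := by
    apply Ex_mono n p hp.le P.hp1
    intro G
    have hsub : (univ.filter fun x => FillC L G x) ⊆
        (FF.filter fun S => EE S ⊆ gE G).biUnion fun S =>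
          (univ.filter fun x : Fin 8 → Fin n => Function.Injective x ∧ cyc x = Bd S) := by
      intro x hx
      simp only [mem_filter, mem_univ, true_and] at hx
      obtain ⟨hinj, S, a1, a2, a3, a4⟩ := hx
      simp only [mem_biUnion, mem_filter, mem_univ, true_and, hFF]
      refine ⟨S, ⟨⟨a2, a3, ?_, ?_⟩, EE_sub_gE G S a1⟩, hinj, a4.symm⟩
      · rw [a4]; exact spt_cyc_card x hinj
      · rw [a4]; exact evenC_cyc x (fun i h => fin8_ne1 i (hinj h))
    have hle := (Finset.card_le_card hsub).trans
      (Finset.card_biUnion_le_card_mul _ _ (8 ^ 8) (by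
        intro S hS
        simp only [mem_filter, mem_univ, true_and, hFF] at hS
        exact card_cyc_fiber _ hS.1.2.2.2 hS.1.2.2.1))
    rw [← Finset.mul_sum, Finset.sum_boole]
    have : ((univ.filter fun x => FillC L G x).card : ℝ) ≤
      ((FF.filter fun S => EE S ⊆ gE G).card * 8 ^ 8 : ℕ) := by exact_mod_cast hle
    push_cast at this
    linarith
  refine h1.trans ?_
  rw [Ex_sum]
  have h2 : ∀ S ∈ FF, Ex n p (fun G => 8 ^ 8 * (if EE S ⊆ gE G then (1 : ℝ) else 0)) =
      8 ^ 8 * ((s / p) ^ 8 * (p ^ (EE S).card * (p / s) ^ (spt (Bd S)).card)) := by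
    intro S hS
    simp only [hFF, mem_filter, mem_univ, true_and] at hS
    rw [Ex_const_mul, Ex_super n p _ (EE_sub_E0 S), hS.2.2.1]
    have h4 : (s / p) ^ 8 * (p / s) ^ 8 = 1 := by
      rw [← mul_pow, div_mul_div_cancel₀ hp.ne', div_self hs.ne', one_pow]
    rw [mul_comm (p ^ _) ((p / s) ^ 8), ← mul_assoc ((s / p) ^ 8), h4, one_mul]
  rw [Finset.sum_congr rfl h2, ← Finset.mul_sum, ← Finset.mul_sum]
  gcongr
  refine (Q2 P (range (8 * L + 1)) (fun A hA => by rw [mem_range] at hA; omega) FF ?_).trans ?_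
  · intro S hS
    simp only [hFF, mem_filter, mem_univ, true_and] at hS
    exact ⟨hS.1, mem_range.2 (by omega)⟩
  · gcongr
    exact sum_geom_le _

lemma card_im (n k : ℕ) (hk : k ≤ 8) :
    (univ.filter fun x : Fin 8 → Fin n => (univ.image x).card = k).card ≤ n ^ k * 8 ^ 8 := by
  have hsub : (univ.filter fun x : Fin 8 → Fin n => (univ.image x).card = k) ⊆
      (powersetCard k univ).biUnion fun W => Fintype.piFinset fun _ : Fin 8 => W := by
    intro x hx
    simp only [mem_filter, mem_univ, true_and] at hx
    simp only [mem_biUnion, mem_powersetCard, Fintype.mem_piFinset]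
    exact ⟨univ.image x, ⟨subset_univ _, hx⟩, fun a => mem_image_of_mem _ (mem_univ a)⟩
  refine (Finset.card_le_card hsub).trans ((Finset.card_biUnion_le_card_mul _ _ (8 ^ 8) ?_).trans ?_)
  · intro W hW
    rw [mem_powersetCard] at hW
    rw [Fintype.card_piFinset]
    simp only [prod_const, hW.2, card_univ, Fintype.card_fin]
    exact Nat.pow_le_pow_left hk 8
  · rw [card_powersetCard, card_univ, Fintype.card_fin]
    exact Nat.mul_le_mul_right _ (Nat.choose_le_pow n k)

lemma sum_im (n : ℕ) (hn : 0 < n) :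
    ∑ x : Fin 8 → Fin n, ((n : ℝ) ^ (univ.image x).card)⁻¹ ≤ 9 * 8 ^ 8 := by
  have hn' : (0 : ℝ) < n := by exact_mod_cast hn
  rw [← Finset.sum_fiberwise_of_maps_to (t := range 9) (g := fun x => (univ.image x).card)
    (fun x _ => by
      rw [mem_range]
      have := Finset.card_image_le (s := univ) (f := x)
      rw [card_univ, Fintype.card_fin] at this
      omega)]
  calc _ ≤ ∑ k ∈ range 9, (8 ^ 8 : ℝ) := by
        apply Finset.sum_le_sum
        intro k hk
        rw [Finset.sum_congr rfl (g := fun _ => ((n : ℝ) ^ k)⁻¹)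
          (fun x hx => by rw [(mem_filter.1 hx).2]), Finset.sum_const, nsmul_eq_mul]
        rw [mul_inv_le_iff₀ (by positivity)]
        have := card_im n k (by rw [mem_range] at hk; omega)
        have h2 : ((univ.filter fun x : Fin 8 → Fin n => (univ.image x).card = k).card : ℝ) ≤
          (n ^ k * 8 ^ 8 : ℕ) := by exact_mod_cast this
        push_cast at h2
        linarith
    _ = _ := by simp

set_option maxHeartbeats 1000000 in
open scoped Classical in
lemma deg_bound {n : ℕ} {p : ℝ} (hp : 0 < p) (hp1 : p ≤ 1) (hn : 0 < n) (hnp : 1 ≤ n * p) :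
    Ex n p (fun G => ((univ.filter fun x => x ∈ H8 G ∧ ¬ Function.Injective x).card : ℝ)) ≤
      ((n * p) ^ 7 + n * (n * p) ^ 4) * (9 * 8 ^ 8) := by
  have hn' : (0 : ℝ) < n := by exact_mod_cast hn
  set XX : Finset (Fin 8 → Fin n) := univ.filter fun x => ¬ Function.Injective x ∧
    univ.image (ce x) ⊆ E0 n with hXX
  have h1 : Ex n p (fun G => ((univ.filter fun x => x ∈ H8 G ∧ ¬ Function.Injective x).card : ℝ)) ≤
      Ex n p (fun G => ∑ x ∈ XX, if univ.image (ce x) ⊆ gE G then (1 : ℝ) else 0) := by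
    apply Ex_mono n p hp.le hp1
    intro G
    rw [Finset.sum_boole]
    refine Nat.cast_le.2 (Finset.card_le_card ?_)
    intro x hx
    simp only [mem_filter, mem_univ, true_and, mem_H8] at hx
    have h : univ.image (ce x) ⊆ gE G := by
      intro e he
      rw [mem_image] at he
      obtain ⟨i, _, rfl⟩ := he
      rw [mem_gE]
      exact hx.1 i
    simp only [mem_filter, mem_univ, true_and, hXX]
    exact ⟨⟨hx.2, h.trans (gE_sub G)⟩, h⟩
  refine h1.trans ?_
  rw [Ex_sum]
  have h2 : ∀ x ∈ XX, Ex n p (fun G => if univ.image (ce x) ⊆ gE G then (1 : ℝ) else 0) ≤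
      ((n * p) ^ 7 + n * (n * p) ^ 4) * ((n : ℝ) ^ (univ.image x).card)⁻¹ := by
    intro x hx
    simp only [mem_filter, mem_univ, true_and, hXX] at hx
    rw [Ex_super n p _ hx.2, ← div_eq_mul_inv, le_div_iff₀ (by positivity)]
    have hV : (univ.image x).card ≤ 7 := by
      have h := Finset.card_image_le (s := univ) (f := x)
      rw [card_univ, Fintype.card_fin] at h
      have h' : (univ.image x).card ≠ 8 := by
        intro h8
        apply hx.1
        have : Set.InjOn x (univ : Finset (Fin 8)) := by
          rw [← Finset.card_image_iff, h8]; simp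
        simpa using this
      omega
    have key : (univ.image x).card ≤ (univ.image (ce x)).card →
        p ^ (univ.image (ce x)).card * (n : ℝ) ^ (univ.image x).card ≤ (n * p) ^ 7 := by
      intro h
      calc p ^ (univ.image (ce x)).card * (n : ℝ) ^ (univ.image x).card ≤
          p ^ (univ.image x).card * (n : ℝ) ^ (univ.image x).card := by
            gcongr ?_ * _
            exact pow_le_pow_of_le_one hp.le hp1 h
        _ = (n * p) ^ (univ.image x).card := by rw [mul_pow]; ring
        _ ≤ _ := pow_le_pow_right₀ hnp hV
    have hA : 0 ≤ (n * p) ^ 7 := by positivity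
    have hB : 0 ≤ n * (n * p) ^ 4 := by positivity
    by_cases hc : (univ.image x).card ≤ (univ.image (ce x)).card
    · linarith [key hc]
    · rcases deg_cases x with h | ⟨h, h4⟩
      · exact absurd h hc
      · have he : (univ.image x).card = (univ.image (ce x)).card + 1 := by omega
        rw [he]
        calc p ^ (univ.image (ce x)).card * (n : ℝ) ^ ((univ.image (ce x)).card + 1)
            = n * (n * p) ^ (univ.image (ce x)).card := by rw [mul_pow, pow_succ]; ring
          _ ≤ n * (n * p) ^ 4 := mul_le_mul_of_nonneg_left (pow_le_pow_right₀ hnp h4) hn'.le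
          _ ≤ _ := le_add_of_nonneg_left hA
  refine (Finset.sum_le_sum h2).trans ?_
  rw [← Finset.mul_sum]
  gcongr
  refine (Finset.sum_le_sum_of_subset_of_nonneg (subset_univ _) ?_).trans (sum_im n hn)
  intros; positivity

end WSat

namespace WSat
open Finset
set_option linter.unusedSectionVars false

def TT (n B : ℕ) : Set (SimpleGraph (Fin n)) :=
  {G | ∃ T : SimpleGraph (Fin n), T.IsTree ∧ T ≤ G ∧ (∀ u v : Fin n, T.dist u v + 1 ≤ B) ∧
    Activates G T G}

open scoped Classical in
lemma tt_struct {n B L : ℕ} (G : SimpleGraph (Fin n)) (hG : G ∈ TT n B) :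
    G ∈ Bad1 n L B ∨ (H8 G).card ≤ (univ.filter fun x => FillC L G x).card +
      (univ.filter fun x => x ∈ H8 G ∧ ¬ Function.Injective x).card := by
  obtain ⟨T, hT, hTG, hd, _, hr⟩ := hG
  rcases (process_fill G T G L hTG hr).2 with h | ⟨e, he, h1, h2⟩
  · right
    refine (Finset.card_le_card ?_).trans (Finset.card_union_le _ _)
    intro x hx
    simp only [mem_union, mem_filter, mem_univ, true_and]
    by_cases hi : Function.Injective x
    · left
      exact ⟨hi, cyc_fill G T hT.isAcyclic L h x hi ((mem_H8 G x).1 hx)⟩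
    · right; exact ⟨hx, hi⟩
  · left
    exact bad_edge G T hT L B hd e he h1 h2

lemma dense_bound {n : ℕ} {p s : ℝ} {M : ℕ} (P : Par n p s M) (L B : ℕ) (hM : 2 * L + 3 ≤ M)
    (hM' : 8 * L + 2 ≤ M) (hn : 2 ≤ n) (hnp : 1 ≤ n * p) :
    gnpProb n p (TT n B) ≤ (s / p) ^ B * (9 / 4 * n * ((L + 1) * (4 / 5 : ℝ) ^ L)) +
      (Real.exp (-(n.choose 2 * p / 2) * (1 - Real.log 2)) +
      (8 ^ 8 * ((s / p) ^ 8 * (9 / 4 * n * 5)) + ((n * p) ^ 7 + n * (n * p) ^ 4) * (9 * 8 ^ 8)) /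
        (n * p / 4) ^ 8) := by
  classical
  have hp := P.hp
  have hn' : (2 : ℝ) ≤ n := by exact_mod_cast hn
  have hs : 0 < s := lt_of_lt_of_le P.hp P.hps
  set X : SimpleGraph (Fin n) → ℝ := fun G => ((univ.filter fun x => FillC L G x).card : ℝ) +
      ((univ.filter fun x => x ∈ H8 G ∧ ¬ Function.Injective x).card : ℝ) with hX
  have h3 : gnpProb n p {G | (n * p / 4) ^ 8 ≤ X G} ≤
      (8 ^ 8 * ((s / p) ^ 8 * (9 / 4 * n * 5)) + ((n * p) ^ 7 + n * (n * p) ^ 4) * (9 * 8 ^ 8)) /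
        (n * p / 4) ^ 8 := by
    refine (prob_le n p hp.le P.hp1 _ (fun G => ((n * p / 4) ^ 8)⁻¹ * X G)
      (fun G => by positivity) ?_).trans ?_
    · intro G hG
      have hG' : (n * p / 4) ^ 8 ≤ X G := hG
      rw [inv_mul_eq_div, le_div_iff₀ (by positivity), one_mul]
      exact hG'
    · rw [Ex_const_mul, inv_mul_eq_div]
      refine div_le_div_of_nonneg_right ?_ (by positivity)
      rw [hX, Ex_add]
      exact add_le_add (fillC_bound P L hM') (deg_bound hp P.hp1 (by omega) hnp)
  refine (prob_union n p hp.le P.hp1 (TT n B) (Bad1 n L B)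
    {G | (edgeCard G : ℝ) ≤ n.choose 2 * p / 2 ∨ (n * p / 4) ^ 8 ≤ X G} ?_).trans
    (add_le_add (bad1_bound P L B hM) ((prob_union n p hp.le P.hp1 _ _ _ ?_).trans
      (add_le_add (prob_few n p hp.le P.hp1) h3)))
  · intro G hG
    rcases tt_struct (L := L) G hG with h | h
    · left; exact h
    · right
      show _ ∨ _
      by_cases hm : (edgeCard G : ℝ) ≤ n.choose 2 * p / 2
      · left; exact hm
      · right
        push Not at hm
        have h1 := H8_lower G (by rw [Fintype.card_fin]; omega)
        rw [Fintype.card_fin] at h1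
        have h2 : (n * p / 4 : ℝ) ≤ 2 * edgeCard G / n := by
          rw [le_div_iff₀ (by linarith)]
          rw [Nat.cast_choose_two] at hm
          nlinarith [mul_nonneg (mul_nonneg hp.le (by linarith : (0 : ℝ) ≤ n))
            (by linarith : (0 : ℝ) ≤ n - 2)]
        calc (n * p / 4 : ℝ) ^ 8 ≤ (2 * edgeCard G / n : ℝ) ^ 8 := by gcongr
          _ ≤ ((H8 G).card : ℝ) := h1
          _ ≤ X G := by simp only [hX]; exact_mod_cast h
  · intro G hG; exact hG

end WSat

namespace WSat
open Finset
set_option linter.unusedSectionVars false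

open scoped Classical in
lemma Ex_disj (n : ℕ) (p : ℝ) (S : Finset (Sym2 (Fin n))) (hS : S ⊆ E0 n) :
    Ex n p (fun G => if Disjoint S (gE G) then 1 else 0) = (1 - p) ^ S.card := by
  unfold Ex
  simp only [gE_card]
  rw [sum_graphs n (fun s => p ^ s.card * (1 - p) ^ (n.choose 2 - s.card) *
    if Disjoint S s then 1 else 0)]
  have : ∀ s ∈ (E0 n).powerset, p ^ s.card * (1 - p) ^ (n.choose 2 - s.card) *
      (if Disjoint S s then (1 : ℝ) else 0)
      = if Disjoint S s then p ^ s.card * (1 - p) ^ (n.choose 2 - s.card) else 0 := by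
    intro s _; split_ifs <;> simp
  rw [Finset.sum_congr rfl this, ← Finset.sum_filter]
  have hf : (E0 n).powerset.filter (fun s => Disjoint S s) = (E0 n \ S).powerset := by
    ext s
    simp only [mem_filter, mem_powerset, subset_sdiff, disjoint_comm]
  rw [hf]
  have h1 : ∀ s ∈ (E0 n \ S).powerset, p ^ s.card * (1 - p) ^ (n.choose 2 - s.card) =
      (1 - p) ^ S.card * (p ^ s.card * (1 - p) ^ ((E0 n \ S).card - s.card)) := by
    intro s hs
    rw [mem_powerset] at hs
    have h2 := Finset.card_le_card hs
    have h3 := Finset.card_sdiff_of_subset hS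
    have h4 := Finset.card_le_card hS
    rw [card_E0] at h3 h4
    rw [show n.choose 2 - s.card = S.card + ((E0 n \ S).card - s.card) by omega, pow_add]
    ring
  rw [Finset.sum_congr rfl h1, ← Finset.mul_sum, Finset.sum_pow_mul_eq_add_pow]
  simp

/-- star -/
def st (n : ℕ) (v : Fin n) : Finset (Sym2 (Fin n)) := (univ.erase v).image fun w => s(v, w)

lemma mem_st {n : ℕ} (v : Fin n) (e) : e ∈ st n v ↔ ∃ w, w ≠ v ∧ s(v, w) = e := by
  simp [st]

lemma st_card (n : ℕ) (v : Fin n) : (st n v).card = n - 1 := by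
  rw [st, Finset.card_image_of_injective]
  · simp
  · intro a b h
    have h' : s(v, a) = s(v, b) := h
    rw [Sym2.eq_iff] at h'
    rcases h' with h' | h'
    · exact h'.2
    · rw [h'.2, h'.1]

lemma st_sub (n : ℕ) (v : Fin n) : st n v ⊆ E0 n := by
  intro e he
  rw [mem_st] at he
  obtain ⟨w, hw, rfl⟩ := he
  simp [E0, hw.symm]

lemma st_union (n : ℕ) (u v : Fin n) (h : u ≠ v) :
    (st n u ∪ st n v).card + 1 = (n - 1) + (n - 1) := by
  have hi : st n u ∩ st n v = {s(u, v)} := by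
    ext e
    rw [mem_inter, mem_st, mem_st, mem_singleton]
    constructor
    · rintro ⟨⟨a, ha, rfl⟩, b, hb, h2⟩
      rw [Sym2.eq_iff] at h2
      rcases h2 with ⟨h2, _⟩ | ⟨h2, _⟩
      · exact absurd h2.symm h
      · rw [h2]
    · rintro rfl
      exact ⟨⟨v, h.symm, rfl⟩, u, h, Sym2.eq_swap⟩
  have := Finset.card_union_add_card_inter (st n u) (st n v)
  rw [hi, card_singleton, st_card, st_card] at this
  exact this

open scoped Classical in
lemma iso_bound (n : ℕ) (p : ℝ) (hn : 2 ≤ n) (hp0 : 0 ≤ p) (hp1 : p < 1) :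
    gnpProb n p {G | ∀ v, ¬ Disjoint (st n v) (gE G)} ≤
      1 / (n * (1 - p) ^ (n - 1)) + (1 / (1 - p) - 1) := by
  set q := 1 - p with hq
  have hq0 : 0 < q := by linarith
  have hn' : (2 : ℝ) ≤ n := by exact_mod_cast hn
  set I : Fin n → SimpleGraph (Fin n) → ℝ := fun v G => if Disjoint (st n v) (gE G) then 1 else 0
    with hI
  set μ : ℝ := n * q ^ (n - 1) with hμ
  have hμ0 : 0 < μ := by positivity
  have h1 : Ex n p (fun G => ∑ v, I v G) = μ := by
    rw [Ex_sum]
    simp only [hI]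
    rw [Finset.sum_congr rfl fun v _ => by rw [Ex_disj n p _ (st_sub n v), st_card]]
    simp [hμ, hq]
  have h2 : Ex n p (fun G => ∑ u, ∑ v, I u G * I v G) ≤ μ + μ ^ 2 / q := by
    rw [Ex_sum]
    have h3 : ∀ u ∈ (univ : Finset (Fin n)), Ex n p (fun G => ∑ v, I u G * I v G) ≤
        q ^ (n - 1) + n * (q ^ (n - 1) * q ^ (n - 1) / q) := by
      intro u _
      rw [Ex_sum]
      have h4 : ∀ v ∈ (univ : Finset (Fin n)), Ex n p (fun G => I u G * I v G) ≤
          (if v = u then q ^ (n - 1) else 0) + q ^ (n - 1) * q ^ (n - 1) / q := by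
        intro v _
        have h5 : (fun G => I u G * I v G) = fun G =>
            if Disjoint (st n u ∪ st n v) (gE G) then (1 : ℝ) else 0 := by
          funext G
          simp only [hI, disjoint_union_left]
          by_cases a : Disjoint (st n u) (gE G) <;> by_cases b : Disjoint (st n v) (gE G) <;>
            simp [a, b]
        rw [h5, Ex_disj n p _ (union_subset (st_sub n u) (st_sub n v))]
        split_ifs with h
        · subst h
          rw [union_self, st_card]
          have : 0 ≤ q ^ (n - 1) * q ^ (n - 1) / q := by positivity
          linarith
        · rw [zero_add, le_div_iff₀ hq0, ← pow_succ, st_union n u v (Ne.symm h), pow_add]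
      refine (Finset.sum_le_sum h4).trans ?_
      rw [Finset.sum_add_distrib]
      simp
    refine (Finset.sum_le_sum h3).trans (le_of_eq ?_)
    rw [Finset.sum_const, card_univ, Fintype.card_fin, nsmul_eq_mul, hμ]
    ring
  have h3 : gnpProb n p {G | ∀ v, ¬ Disjoint (st n v) (gE G)} ≤
      Ex n p (fun G => (μ ^ 2)⁻¹ * ((∑ v, I v G) - μ) ^ 2) := by
    apply prob_le n p hp0 hp1.le
    · intro G; positivity
    · intro G hG
      have hG' : ∀ v, ¬ Disjoint (st n v) (gE G) := hG
      have : ∑ v, I v G = 0 := by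
        apply Finset.sum_eq_zero
        intro v _
        simp [hI, hG' v]
      rw [this, zero_sub, neg_sq, inv_mul_cancel₀ (by positivity)]
  refine h3.trans ?_
  have h4 : (fun G => (μ ^ 2)⁻¹ * ((∑ v, I v G) - μ) ^ 2) = fun G =>
      (μ ^ 2)⁻¹ * ((∑ u, ∑ v, I u G * I v G) + ((-(2 * μ)) * (∑ v, I v G) + μ ^ 2 * 1)) := by
    funext G
    rw [← Finset.sum_mul_sum]
    ring
  rw [h4, Ex_const_mul, Ex_add, Ex_add, Ex_const_mul, Ex_const_mul, Ex_one, h1, inv_mul_eq_div,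
    div_le_iff₀ (by positivity)]
  have : (1 / μ + (1 / q - 1)) * μ ^ 2 = μ + μ ^ 2 / q - μ ^ 2 := by field_simp; ring
  rw [this]
  linarith

lemma tt_noiso {n B : ℕ} (hn : 2 ≤ n) (G : SimpleGraph (Fin n)) (hG : G ∈ TT n B) (v : Fin n) :
    ¬ Disjoint (st n v) (gE G) := by
  obtain ⟨T, hT, hTG, _, _⟩ := hG
  have : Nontrivial (Fin n) := Fin.nontrivial_iff_two_le.2 hn
  obtain ⟨w, hw⟩ := hT.connected.preconnected.exists_adj_of_nontrivial v
  rw [Finset.not_disjoint_iff]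
  exact ⟨s(v, w), (mem_st _ _).2 ⟨w, hw.ne', rfl⟩, (mem_gE _ _).2 (hTG hw)⟩

section tri
variable {V : Type} [Fintype V] [DecidableEq V]

open scoped Classical in
noncomputable def triS (G : SimpleGraph V) : Finset (Finset V) := univ.filter fun t => G.IsNClique 3 t

lemma mem_triS (G : SimpleGraph V) (t) : t ∈ triS G ↔ G.IsNClique 3 t := by simp [triS]

lemma step_count (G A B : SimpleGraph V) (h : BootStep G A B) :
    edgeCard B + (triS A).card ≤ edgeCard A + (triS B).card := by
  obtain ⟨u, v, huv, hA, rfl, w, h1, h2⟩ := h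
  have hne := huv.ne
  have he : edgeCard (A ⊔ SimpleGraph.fromEdgeSet {s(u, v)}) ≤ edgeCard A + 1 := by
    unfold edgeCard
    rw [Nat.card_coe_set_eq, Nat.card_coe_set_eq]
    refine le_trans (Set.ncard_le_ncard ?_ (Set.toFinite _)) (Set.ncard_insert_le s(u, v) A.edgeSet)
    intro e he
    rw [SimpleGraph.edgeSet_sup, SimpleGraph.edgeSet_fromEdgeSet] at he
    rcases he with he | he
    · exact Set.mem_insert_of_mem _ he
    · left; exact he.1
  have ht : (triS A).card < (triS (A ⊔ SimpleGraph.fromEdgeSet {s(u, v)})).card := by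
    apply Finset.card_lt_card
    rw [Finset.ssubset_iff_of_subset]
    · refine ⟨{u, v, w}, ?_, ?_⟩
      · rw [mem_triS, SimpleGraph.is3Clique_triple_iff]
        simp [h1, h2, hne]
      · rw [mem_triS, SimpleGraph.is3Clique_triple_iff]
        tauto
    · intro t ht
      rw [mem_triS] at ht ⊢
      exact ht.mono le_sup_left
  omega

lemma process_count (G T H : SimpleGraph V) (h : Relation.ReflTransGen (BootStep G) T H) :
    edgeCard H ≤ edgeCard T + (triS H).card := by
  induction h with
  | refl => omega
  | tail _ hs ih => have := step_count _ _ _ hs; omega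

end tri

lemma tt_count {n B : ℕ} (G : SimpleGraph (Fin n)) (hG : G ∈ TT n B) :
    edgeCard G + 1 ≤ n + (triS G).card := by
  classical
  obtain ⟨T, hT, _, _, _, hr⟩ := hG
  have h1 := process_count G T G hr
  have h2 := hT.card_edgeFinset
  rw [Fintype.card_fin] at h2
  have h3 : edgeCard T = T.edgeFinset.card := by
    rw [edgeCard, Nat.card_eq_fintype_card, SimpleGraph.edgeFinset_card]
  omega

lemma EE_single {n : ℕ} (t : Finset (Fin n)) (ht : t.card = 3) : 3 ≤ (EE {t}).card := by
  obtain ⟨a, b, c, hab, hac, hbc, rfl⟩ := Finset.card_eq_three.1 ht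
  have h : ({s(a, b), s(a, c), s(b, c)} : Finset (Sym2 (Fin n))).card = 3 := by
    rw [Finset.card_eq_three]
    refine ⟨_, _, _, ?_, ?_, ?_, rfl⟩ <;> simp [hab, hac, hbc, hab.symm, hbc.symm]
  rw [← h]
  apply Finset.card_le_card
  intro e he
  simp only [mem_insert, mem_singleton] at he
  simp only [EE, mem_filter, mem_univ, true_and, mem_singleton, exists_eq_left]
  rcases he with rfl | rfl | rfl <;> simp [hab, hac, hbc]

lemma tri_bound (n : ℕ) (p : ℝ) (hp0 : 0 ≤ p) (hp1 : p ≤ 1) :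
    Ex n p (fun G => ((triS G).card : ℝ)) ≤ (n * p) ^ 3 := by
  classical
  have h1 : Ex n p (fun G => ((triS G).card : ℝ)) ≤
      Ex n p (fun G => ∑ t ∈ powersetCard 3 univ, if EE {t} ⊆ gE G then (1 : ℝ) else 0) := by
    apply Ex_mono n p hp0 hp1
    intro G
    rw [Finset.sum_boole]
    refine Nat.cast_le.2 (Finset.card_le_card ?_)
    intro t ht
    rw [mem_triS] at ht
    rw [mem_filter, mem_powersetCard]
    exact ⟨⟨subset_univ _, ht.card_eq⟩, EE_sub_gE G {t} (by
      intro t' ht'; rw [mem_singleton] at ht'; rwa [ht'])⟩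
  refine h1.trans ?_
  rw [Ex_sum]
  calc _ ≤ ∑ t ∈ powersetCard 3 (univ : Finset (Fin n)), p ^ 3 := by
        apply Finset.sum_le_sum
        intro t ht
        rw [mem_powersetCard] at ht
        rw [Ex_super n p _ (EE_sub_E0 _)]
        exact pow_le_pow_of_le_one hp0 hp1 (EE_single t ht.2)
    _ ≤ _ := by
      rw [Finset.sum_const, card_powersetCard, card_univ, Fintype.card_fin, nsmul_eq_mul, mul_pow]
      gcongr
      exact_mod_cast Nat.choose_le_pow n 3

lemma sparse_iso {n B : ℕ} {p : ℝ} (hn : 2 ≤ n) (hp0 : 0 ≤ p) (hp1 : p < 1) :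
    gnpProb n p (TT n B) ≤ 1 / (n * (1 - p) ^ (n - 1)) + (1 / (1 - p) - 1) := by
  have h := prob_union n p hp0 hp1.le (TT n B) {G | ∀ v, ¬ Disjoint (st n v) (gE G)} ∅
    (fun G hG => Or.inl fun v => tt_noiso hn G hG v)
  have h0 : gnpProb n p ∅ = 0 := by simp [gnpProb]
  rw [h0, add_zero] at h
  exact h.trans (iso_bound n p hn hp0 hp1)

lemma sparse_count {n B : ℕ} {p : ℝ} (hn : 2 ≤ n) (hp0 : 0 ≤ p) (hp1 : p ≤ 1) (hnp : 8 ≤ n * p) :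
    gnpProb n p (TT n B) ≤ Real.exp (-(n.choose 2 * p / 2) * (1 - Real.log 2)) +
      (n * p) ^ 3 / (n - 1) := by
  have hn' : (2 : ℝ) ≤ n := by exact_mod_cast hn
  refine (prob_union n p hp0 hp1 (TT n B) _ {G | (n - 1 : ℝ) ≤ (triS G).card} ?_).trans
    (add_le_add (prob_few n p hp0 hp1) ?_)
  · intro G hG
    by_cases hm : (edgeCard G : ℝ) ≤ n.choose 2 * p / 2
    · left; exact hm
    · right
      push Not at hm
      have h1 : (edgeCard G + 1 : ℝ) ≤ n + (triS G).card := by exact_mod_cast tt_count G hG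
      rw [Nat.cast_choose_two] at hm
      show (n - 1 : ℝ) ≤ (triS G).card
      nlinarith
  · refine (prob_le n p hp0 hp1 _ (fun G => (n - 1 : ℝ)⁻¹ * ((triS G).card : ℝ)) ?_ ?_).trans ?_
    · intro G
      exact mul_nonneg (inv_nonneg.2 (by linarith)) (Nat.cast_nonneg _)
    · intro G hG
      have hG' : (n - 1 : ℝ) ≤ (triS G).card := hG
      rw [inv_mul_eq_div, le_div_iff₀ (by linarith), one_mul]
      exact hG'
    · rw [Ex_const_mul, inv_mul_eq_div]
      exact div_le_div_of_nonneg_right (tri_bound n p hp0 hp1) (by linarith)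

end WSat

namespace WSat
open Finset
set_option linter.unusedSectionVars false

lemma few_num {n : ℕ} {p : ℝ} (hn : 16 ≤ n) (hp : 8 ≤ n * p) :
    Real.exp (-(n.choose 2 * p / 2) * (1 - Real.log 2)) ≤ Real.exp (-(3 / 10 * n)) := by
  have hn' : (16 : ℝ) ≤ n := by exact_mod_cast hn
  apply Real.exp_le_exp.2
  rw [Nat.cast_choose_two]
  have hl := Real.log_two_lt_d9
  have h1 : (n : ℝ) ≤ n * (n - 1) / 2 * p / 2 := by nlinarith
  nlinarith

lemma case_a {n B : ℕ} {p : ℝ} (hn : 16 ≤ n) (hp0 : 0 ≤ p) (hnp : n * p ≤ 8) :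
    gnpProb n p (TT n B) ≤ (Real.exp 16 + 16) * (n : ℝ)⁻¹ := by
  have hn' : (16 : ℝ) ≤ n := by exact_mod_cast hn
  have hp2 : p ≤ 1 / 2 := by nlinarith
  have h1 : Real.exp (-(2 * p)) ≤ 1 - p := by
    rw [Real.exp_neg]
    have h2 := Real.add_one_le_exp (2 * p)
    rw [inv_le_iff_one_le_mul₀ (Real.exp_pos _)]
    nlinarith
  have h2 : Real.exp (-16) ≤ (1 - p) ^ (n - 1) := by
    calc Real.exp (-16) ≤ Real.exp (-(2 * p)) ^ (n - 1) := by
          rw [← Real.exp_nat_mul]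
          apply Real.exp_le_exp.2
          have h3 : ((n - 1 : ℕ) : ℝ) ≤ n := by exact_mod_cast Nat.sub_le n 1
          nlinarith
      _ ≤ _ := by gcongr
  refine (sparse_iso (by omega) hp0 (by linarith)).trans ?_
  rw [add_mul]
  apply add_le_add
  · rw [div_le_iff₀ (by have : 0 < 1 - p := by linarith
                        positivity)]
    have h3 : Real.exp 16 * Real.exp (-16) = 1 := by rw [← Real.exp_add]; simp
    calc (1 : ℝ) = Real.exp 16 * (n : ℝ)⁻¹ * (n * Real.exp (-16)) := by
          rw [show Real.exp 16 * (n : ℝ)⁻¹ * (n * Real.exp (-16)) =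
            (Real.exp 16 * Real.exp (-16)) * ((n : ℝ)⁻¹ * n) by ring, h3,
            inv_mul_cancel₀ (by positivity), one_mul]
      _ ≤ _ := by gcongr
  · rw [← div_eq_mul_inv, le_div_iff₀ (by positivity), div_sub_one (by linarith), div_mul_eq_mul_div,
      div_le_iff₀ (by linarith)]
    nlinarith

lemma case_b {n B : ℕ} {p : ℝ} (hn : 16 ≤ n) (hp0 : 0 ≤ p) (hp1 : p ≤ 1) (h8 : 8 ≤ n * p)
    (hnp : n * p ≤ (n : ℝ) ^ (3 / 10 : ℝ)) :
    gnpProb n p (TT n B) ≤ Real.exp (-(3 / 10 * n)) + 2 * (n : ℝ) ^ (-(1 / 10) : ℝ) := by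
  have hn' : (16 : ℝ) ≤ n := by exact_mod_cast hn
  refine (sparse_count (by omega) hp0 hp1 h8).trans (add_le_add (few_num hn h8) ?_)
  rw [div_le_iff₀ (by linarith)]
  calc (n * p) ^ 3 ≤ ((n : ℝ) ^ (3 / 10 : ℝ)) ^ 3 := by gcongr
    _ = (n : ℝ) ^ (-(1 / 10) : ℝ) * n := by
      rw [← Real.rpow_natCast, ← Real.rpow_mul (by positivity)]
      nth_rewrite 3 [← Real.rpow_one (n : ℝ)]
      rw [← Real.rpow_add (by positivity)]
      norm_num
    _ ≤ _ := by
      have : 0 ≤ (n : ℝ) ^ (-(1 / 10) : ℝ) := by positivity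
      nlinarith

lemma case_c {n B : ℕ} {p : ℝ} (hn : 16 ≤ n) (hp0 : 0 < p) (hp1 : p ≤ 1) (h8 : 8 ≤ n * p)
    (hnp : (n : ℝ) ^ (3 / 10 : ℝ) ≤ n * p) (hp3 : n * p ^ 3 ≤ 1 / 128)
    (hB : (B : ℝ) ≤ (n : ℝ) ^ (1 / 18 : ℝ) + 1)
    (E2 : 32 * ((n : ℝ) ^ (1 / 10 : ℝ) + 1) + 8 ≤ (n : ℝ) ^ (3 / 20 : ℝ))
    (E3 : 9 / 4 * ((n : ℝ) ^ (1 / 10 : ℝ) + 2) ≤ (n : ℝ) ^ 2)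
    (E4 : ((n : ℝ) ^ (1 / 18 : ℝ) + 4) * Real.log n ≤ (n : ℝ) ^ (1 / 10 : ℝ) / 10) :
    gnpProb n p (TT n B) ≤ Real.exp (-((n : ℝ) ^ (1 / 10 : ℝ) / 10)) +
      (Real.exp (-(3 / 10 * n)) + 8 ^ 8 * 4 ^ 8 * 30 * (n : ℝ) ^ (-(1 / 5) : ℝ)) := by
  have hn' : (16 : ℝ) ≤ n := by exact_mod_cast hn
  have hn0 : (0 : ℝ) < n := by linarith
  obtain ⟨L, hL⟩ : ∃ L : ℕ, L = ⌈(n : ℝ) ^ (1 / 10 : ℝ)⌉₊ := ⟨_, rfl⟩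
  have hL1 : (n : ℝ) ^ (1 / 10 : ℝ) ≤ L := by rw [hL]; exact Nat.le_ceil _
  have hL2 : (L : ℝ) ≤ (n : ℝ) ^ (1 / 10 : ℝ) + 1 := by
    rw [hL]; exact (Nat.ceil_lt_add_one (by positivity)).le
  have hL0 : 1 ≤ L := by
    rw [hL]; exact Nat.one_le_ceil_iff.2 (by positivity)
  obtain ⟨y, hy⟩ : ∃ y : ℝ, y = n * p := ⟨_, rfl⟩
  obtain ⟨r, hr⟩ : ∃ r : ℝ, r = Real.sqrt y := ⟨_, rfl⟩
  rw [← hy] at h8 hnp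
  have hr2 : r ^ 2 = y := by rw [hr]; exact Real.sq_sqrt (by linarith)
  have hr0 : 0 < r := by rw [hr]; exact Real.sqrt_pos.2 (by linarith)
  have hr1 : 1 ≤ r := by nlinarith
  have hrn : (n : ℝ) ^ (3 / 20 : ℝ) ≤ r := by
    rw [hr]
    apply Real.le_sqrt_of_sq_le
    rw [← Real.rpow_natCast, ← Real.rpow_mul (by positivity)]
    norm_num at hnp ⊢
    exact hnp
  have hry : r ≤ n := by nlinarith
  have hsp : p * r / p = r := by field_simp
  have P : Par n p (p * r) (8 * L + 2) := by
    refine ⟨hp0, ?_, hp1, ?_, ?_⟩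
    · nlinarith
    · have h1 : n * (p ^ 3 / (p * r)) = p * r := by
        have : n * p ^ 3 = p * r * (p * r) := by
          rw [show p * r * (p * r) = p ^ 2 * r ^ 2 by ring, hr2, hy]; ring
        rw [← mul_div_assoc, this]
        field_simp
      rw [h1]
      push_cast
      have h2 : (8 * L + 2 : ℝ) ≤ r / 4 := by linarith
      nlinarith [mul_le_mul_of_nonneg_left h2 hp0.le]
    · have h1 : (p * r) ^ 2 ≤ (4 / 45) ^ 2 := by
        rw [mul_pow, hr2, hy]
        nlinarith
      have := abs_le_of_sq_le_sq h1 (by norm_num)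
      linarith [le_abs_self (p * r)]
  refine (dense_bound P L B (by omega) le_rfl (by omega) (by rw [← hy]; linarith)).trans ?_
  rw [hsp]
  refine add_le_add ?_ (add_le_add (few_num hn (by rw [← hy]; exact h8)) ?_)
  · have h1 : r ^ B ≤ Real.exp (((n : ℝ) ^ (1 / 18 : ℝ) + 1) * Real.log n) := by
      calc r ^ B ≤ (n : ℝ) ^ B := by gcongr
        _ = Real.exp (B * Real.log n) := by
          rw [Real.exp_nat_mul, Real.exp_log hn0]
        _ ≤ _ := by
          apply Real.exp_le_exp.2
          have : 0 ≤ Real.log n := Real.log_nonneg (by linarith)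
          gcongr
    have h2 : 9 / 4 * n * ((L + 1) * (4 / 5 : ℝ) ^ L) ≤
        Real.exp (3 * Real.log n) * Real.exp (-((n : ℝ) ^ (1 / 10 : ℝ) / 5)) := by
      have h3 : (4 / 5 : ℝ) ^ L ≤ Real.exp (-((n : ℝ) ^ (1 / 10 : ℝ) / 5)) := by
        calc (4 / 5 : ℝ) ^ L ≤ Real.exp (-(1 / 5)) ^ L := by
              have := Real.add_one_le_exp (-(1 / 5) : ℝ)
              gcongr
              linarith
          _ = Real.exp (L * (-(1 / 5))) := by rw [Real.exp_nat_mul]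
          _ ≤ _ := by apply Real.exp_le_exp.2; linarith
      have h4 : 9 / 4 * n * (L + 1) ≤ Real.exp (3 * Real.log n) := by
        have : Real.exp (3 * Real.log n) = (n : ℝ) ^ 3 := by
          have := Real.exp_nat_mul (Real.log n) 3
          rw [Real.exp_log hn0] at this
          exact_mod_cast this
        rw [this]
        have : 9 / 4 * (L + 1 : ℝ) ≤ (n : ℝ) ^ 2 := by linarith
        calc 9 / 4 * n * (L + 1) = n * (9 / 4 * (L + 1 : ℝ)) := by ring
          _ ≤ n * (n : ℝ) ^ 2 := by gcongr
          _ = _ := by ring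
      calc 9 / 4 * n * ((L + 1) * (4 / 5 : ℝ) ^ L) = (9 / 4 * n * (L + 1)) * (4 / 5 : ℝ) ^ L := by ring
        _ ≤ _ := by gcongr
    calc _ ≤ Real.exp (((n : ℝ) ^ (1 / 18 : ℝ) + 1) * Real.log n) *
          (Real.exp (3 * Real.log n) * Real.exp (-((n : ℝ) ^ (1 / 10 : ℝ) / 5))) := by gcongr
      _ ≤ _ := by
        rw [← Real.exp_add, ← Real.exp_add]
        apply Real.exp_le_exp.2
        linarith
  · rw [← hy, show r ^ 8 = y ^ 4 by rw [← hr2]; ring]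
    have hy0 : 0 < y := by linarith
    rw [div_le_iff₀ (by positivity)]
    set z := (n : ℝ) ^ (-(1 / 5) : ℝ) with hz
    have hz0 : 0 < z := by positivity
    have h1 : (n : ℝ) ≤ z * y ^ 4 := by
      calc (n : ℝ) = z * ((n : ℝ) ^ (3 / 10 : ℝ)) ^ 4 := by
            rw [hz, ← Real.rpow_natCast, ← Real.rpow_mul (by positivity),
              ← Real.rpow_add (by positivity)]
            norm_num
        _ ≤ _ := by gcongr
    have h2 : 1 ≤ z * y := by
      calc (1 : ℝ) ≤ (n : ℝ) ^ (1 / 10 : ℝ) := Real.one_le_rpow (by linarith) (by norm_num)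
        _ = z * (n : ℝ) ^ (3 / 10 : ℝ) := by
            rw [hz, ← Real.rpow_add (by positivity)]
            norm_num
        _ ≤ _ := by gcongr
    have h3 : n * y ^ 4 ≤ z * y ^ 8 := by
      calc n * y ^ 4 ≤ (z * y ^ 4) * y ^ 4 := by gcongr
        _ = _ := by ring
    have h4 : y ^ 7 ≤ z * y ^ 8 := by
      calc y ^ 7 = 1 * y ^ 7 := by ring
        _ ≤ (z * y) * y ^ 7 := by gcongr
        _ = _ := by ring
    have h5 : 0 ≤ z * y ^ 8 := by positivity
    have e1 : 8 ^ 8 * (y ^ 4 * (9 / 4 * n * 5)) + (y ^ 7 + n * y ^ 4) * (9 * 8 ^ 8) =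
      8 ^ 8 * (81 / 4 * (n * y ^ 4) + 9 * y ^ 7) := by ring
    have e2 : 8 ^ 8 * 4 ^ 8 * 30 * z * (y / 4) ^ 8 = 8 ^ 8 * (30 * (z * y ^ 8)) := by ring
    rw [e1, e2]
    gcongr ?_ * ?_
    linarith

noncomputable def UU (n : ℕ) : ℝ := (Real.exp 16 + 16) * (n : ℝ)⁻¹ + 2 * (n : ℝ) ^ (-(1 / 10) : ℝ) +
  Real.exp (-(3 / 10 * n)) + Real.exp (-((n : ℝ) ^ (1 / 10 : ℝ) / 10)) +
    8 ^ 8 * 4 ^ 8 * 30 * (n : ℝ) ^ (-(1 / 5) : ℝ)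

lemma UU_tendsto : Filter.Tendsto UU Filter.atTop (nhds 0) := by
  have hc := tendsto_natCast_atTop_atTop (R := ℝ)
  have h1 : Filter.Tendsto (fun n : ℕ => (Real.exp 16 + 16) * (n : ℝ)⁻¹) Filter.atTop (nhds 0) := by
    have := (tendsto_inv_atTop_zero.comp hc).const_mul (Real.exp 16 + 16)
    simpa using this
  have h2 : Filter.Tendsto (fun n : ℕ => 2 * (n : ℝ) ^ (-(1 / 10) : ℝ)) Filter.atTop (nhds 0) := by
    have := ((tendsto_rpow_neg_atTop (y := 1 / 10) (by norm_num)).comp hc).const_mul 2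
    rw [mul_zero] at this
    exact this
  have h3 : Filter.Tendsto (fun n : ℕ => Real.exp (-(3 / 10 * (n : ℝ)))) Filter.atTop (nhds 0) := by
    exact Real.tendsto_exp_neg_atTop_nhds_zero.comp
      (hc.const_mul_atTop (by norm_num : (0 : ℝ) < 3 / 10))
  have h4 : Filter.Tendsto (fun n : ℕ => Real.exp (-((n : ℝ) ^ (1 / 10 : ℝ) / 10))) Filter.atTop
      (nhds 0) := by
    exact Real.tendsto_exp_neg_atTop_nhds_zero.comp
      (((tendsto_rpow_atTop (by norm_num)).comp hc).atTop_div_const (by norm_num : (0 : ℝ) < 10))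
  have h5 : Filter.Tendsto (fun n : ℕ => 8 ^ 8 * 4 ^ 8 * 30 * (n : ℝ) ^ (-(1 / 5) : ℝ)) Filter.atTop
      (nhds 0) := by
    have := ((tendsto_rpow_neg_atTop (y := 1 / 5) (by norm_num)).comp hc).const_mul
      (8 ^ 8 * 4 ^ 8 * 30)
    rw [mul_zero] at this
    exact this
  have := (((h1.add h2).add h3).add h4).add h5
  simp only [add_zero] at this
  exact this

lemma rpow_ev (c d a b : ℝ) (hb : a < b) :
    ∀ᶠ x : ℝ in Filter.atTop, c * x ^ a ≤ d * x ^ b ∨ d ≤ 0 := by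
  by_cases hd : d ≤ 0
  · exact Filter.Eventually.of_forall fun _ => Or.inr hd
  push Not at hd
  have h := (tendsto_rpow_atTop (sub_pos.2 hb)).eventually_ge_atTop (c / d)
  filter_upwards [h, Filter.eventually_gt_atTop 0] with x hx hx0
  left
  rw [Real.rpow_sub hx0, le_div_iff₀ (by positivity), div_mul_eq_mul_div, div_le_iff₀ hd] at hx
  linarith

lemma ev_all : ∀ᶠ n : ℕ in Filter.atTop, 16 ≤ n ∧
    32 * ((n : ℝ) ^ (1 / 10 : ℝ) + 1) + 8 ≤ (n : ℝ) ^ (3 / 20 : ℝ) ∧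
    9 / 4 * ((n : ℝ) ^ (1 / 10 : ℝ) + 2) ≤ (n : ℝ) ^ 2 ∧
    ((n : ℝ) ^ (1 / 18 : ℝ) + 4) * Real.log n ≤ (n : ℝ) ^ (1 / 10 : ℝ) / 10 := by
  have hc := tendsto_natCast_atTop_atTop (R := ℝ)
  have h2 := hc.eventually (rpow_ev 72 1 (1 / 10) (3 / 20) (by norm_num))
  have h3 := hc.eventually (rpow_ev 7 1 (1 / 10) 2 (by norm_num))
  have h4 := hc.eventually (rpow_ev 5 (1 / 10) (1 / 18 + 1 / 25) (1 / 10) (by norm_num))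
  have hl := hc.eventually ((isLittleO_log_rpow_atTop (r := 1 / 25) (by norm_num)).bound
    (c := 1) (by norm_num))
  filter_upwards [h2, h3, h4, hl, Filter.eventually_ge_atTop 16] with n h2 h3 h4 hl hn
  have hn' : (16 : ℝ) ≤ n := by exact_mod_cast hn
  have hn0 : (0 : ℝ) < n := by linarith
  have ha : (1 : ℝ) ≤ (n : ℝ) ^ (1 / 10 : ℝ) := Real.one_le_rpow (by linarith) (by norm_num)
  have hb : (1 : ℝ) ≤ (n : ℝ) ^ (1 / 18 : ℝ) := Real.one_le_rpow (by linarith) (by norm_num)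
  have h2 := h2.resolve_right (by norm_num)
  have h3 := h3.resolve_right (by norm_num)
  have h4 := h4.resolve_right (by norm_num)
  refine ⟨hn, by linarith, ?_, ?_⟩
  · rw [Real.rpow_two] at h3
    linarith
  · rw [one_mul, Real.norm_of_nonneg (Real.log_nonneg (by linarith)),
      Real.norm_of_nonneg (by positivity)] at hl
    calc ((n : ℝ) ^ (1 / 18 : ℝ) + 4) * Real.log n ≤
        (5 * (n : ℝ) ^ (1 / 18 : ℝ)) * (n : ℝ) ^ (1 / 25 : ℝ) := by
          gcongr
          linarith
      _ = 5 * (n : ℝ) ^ (1 / 18 + 1 / 25 : ℝ) := by rw [Real.rpow_add hn0]; ring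
      _ ≤ _ := h4
      _ = _ := by ring

lemma cube_bound {ε x : ℝ} (hε : 0 < ε) {n : ℕ} (hn : 1 ≤ n) (hx0 : 0 ≤ x)
    (hx : x < ((2 : ℝ) ^ (-(7 : ℝ) / 3) - ε) * (n : ℝ) ^ (-(1 : ℝ) / 3)) :
    n * x ^ 3 ≤ 1 / 128 := by
  have hn0 : (0 : ℝ) < n := by exact_mod_cast hn
  have h1 : x ≤ (2 : ℝ) ^ (-(7 : ℝ) / 3) * (n : ℝ) ^ (-(1 : ℝ) / 3) := by
    refine hx.le.trans ?_
    gcongr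
    linarith
  have h2 : ((2 : ℝ) ^ (-(7 : ℝ) / 3)) ^ 3 = 1 / 128 := by
    rw [← Real.rpow_natCast, ← Real.rpow_mul (by norm_num)]
    norm_num
  have h3 : ((n : ℝ) ^ (-(1 : ℝ) / 3)) ^ 3 = (n : ℝ)⁻¹ := by
    rw [← Real.rpow_natCast, ← Real.rpow_mul (by positivity), ← Real.rpow_neg_one]
    norm_num
  calc n * x ^ 3 ≤ n * ((2 : ℝ) ^ (-(7 : ℝ) / 3) * (n : ℝ) ^ (-(1 : ℝ) / 3)) ^ 3 := by gcongr
    _ = _ := by rw [mul_pow, h2, h3]; field_simp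

end WSat

namespace WSat

lemma TT_bound {n B : ℕ} {p : ℝ} (hn : 16 ≤ n) (hp0 : 0 ≤ p) (hp3 : n * p ^ 3 ≤ 1 / 128)
    (hB : (B : ℝ) ≤ (n : ℝ) ^ (1 / 18 : ℝ) + 1)
    (E2 : 32 * ((n : ℝ) ^ (1 / 10 : ℝ) + 1) + 8 ≤ (n : ℝ) ^ (3 / 20 : ℝ))
    (E3 : 9 / 4 * ((n : ℝ) ^ (1 / 10 : ℝ) + 2) ≤ (n : ℝ) ^ 2)
    (E4 : ((n : ℝ) ^ (1 / 18 : ℝ) + 4) * Real.log n ≤ (n : ℝ) ^ (1 / 10 : ℝ) / 10) :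
    p ≤ 1 ∧ gnpProb n p (TT n B) ≤ UU n := by
  have hn' : (16 : ℝ) ≤ n := by exact_mod_cast hn
  have hn0 : (0 : ℝ) < n := by linarith
  have hp1 : p ≤ 1 := by
    by_contra h
    push Not at h
    have : 1 ≤ p ^ 3 := one_le_pow₀ h.le
    nlinarith
  refine ⟨hp1, ?_⟩
  have a1 : 0 ≤ (Real.exp 16 + 16) * (n : ℝ)⁻¹ := by positivity
  have a2 : 0 ≤ 2 * (n : ℝ) ^ (-(1 / 10) : ℝ) := by positivity
  have a3 := Real.exp_pos (-(3 / 10 * n))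
  have a4 := Real.exp_pos (-((n : ℝ) ^ (1 / 10 : ℝ) / 10))
  have a5 : 0 ≤ 8 ^ 8 * 4 ^ 8 * 30 * (n : ℝ) ^ (-(1 / 5) : ℝ) := by positivity
  unfold UU
  by_cases h8 : n * p ≤ 8
  · have := case_a (B := B) hn hp0 h8
    linarith
  push Not at h8
  rcases le_total (n * p) ((n : ℝ) ^ (3 / 10 : ℝ)) with h | h
  · have := case_b (B := B) hn hp0 hp1 h8.le h
    linarith
  · have hpp : 0 < p := by
      rcases hp0.lt_or_eq with h | h
      · exact h
      · rw [← h] at h8; norm_num at h8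
    have := case_c hn hpp hp1 h8.le h hp3 hB E2 E3 E4
    linarith

/-- If `p < (2^{-7/3} − ε) n^{-1/3}` then w.h.p. there is no tree
`T ⊆ G` of diameter at most `n^{1/18-ε}` with `T → G`, for `G ∼ G_{n,p}`. -/
theorem statement3 (ε : ℝ) (hε : 0 < ε) (p : ℕ → ℝ)
    (hp0 : ∀ n : ℕ, 0 ≤ p n)
    (hp : ∀ n : ℕ, 1 ≤ n →
      p n < ((2 : ℝ) ^ (-(7 : ℝ) / 3) - ε) * (n : ℝ) ^ (-(1 : ℝ) / 3)) :
    Filter.Tendsto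
      (fun n => gnpProb n (p n)
        {G | ¬ ∃ T : SimpleGraph (Fin n), T.IsTree ∧ T ≤ G ∧
          (∀ u v : Fin n, (T.dist u v : ℝ) ≤ (n : ℝ) ^ ((1 : ℝ) / 18 - ε)) ∧
          Activates G T G})
      Filter.atTop (nhds 1) := by
  have hkey : ∀ᶠ n : ℕ in Filter.atTop, 1 - UU n ≤ gnpProb n (p n)
        {G | ¬ ∃ T : SimpleGraph (Fin n), T.IsTree ∧ T ≤ G ∧
          (∀ u v : Fin n, (T.dist u v : ℝ) ≤ (n : ℝ) ^ ((1 : ℝ) / 18 - ε)) ∧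
          Activates G T G} ∧ gnpProb n (p n)
        {G | ¬ ∃ T : SimpleGraph (Fin n), T.IsTree ∧ T ≤ G ∧
          (∀ u v : Fin n, (T.dist u v : ℝ) ≤ (n : ℝ) ^ ((1 : ℝ) / 18 - ε)) ∧
          Activates G T G} ≤ 1 := by
    filter_upwards [ev_all] with n ⟨hn, E2, E3, E4⟩
    have hn' : (16 : ℝ) ≤ n := by exact_mod_cast hn
    obtain ⟨B, hBdef⟩ : ∃ B : ℕ, B = ⌊(n : ℝ) ^ (1 / 18 : ℝ)⌋₊ + 1 := ⟨_, rfl⟩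
    have hB : (B : ℝ) ≤ (n : ℝ) ^ (1 / 18 : ℝ) + 1 := by
      rw [hBdef]
      push_cast
      have := Nat.floor_le (a := (n : ℝ) ^ (1 / 18 : ℝ)) (by positivity)
      linarith
    obtain ⟨hp1, hT⟩ := TT_bound hn (hp0 n)
      (cube_bound hε (by omega) (hp0 n) (hp n (by omega))) hB E2 E3 E4
    set A : Set (SimpleGraph (Fin n)) := {G | ∃ T : SimpleGraph (Fin n), T.IsTree ∧ T ≤ G ∧
          (∀ u v : Fin n, (T.dist u v : ℝ) ≤ (n : ℝ) ^ ((1 : ℝ) / 18 - ε)) ∧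
          Activates G T G} with hA
    have h1 := prob_compl n (p n) A
    have h2 := prob_nonneg n (p n) (hp0 n) hp1 A
    have h3 : gnpProb n (p n) A ≤ gnpProb n (p n) (TT n B) := by
      have h := prob_union n (p n) (hp0 n) hp1 A (TT n B) ∅ (by
        rintro G ⟨T, b1, b2, b3, b4⟩
        left
        refine ⟨T, b1, b2, ?_, b4⟩
        intro u v
        rw [hBdef]
        apply Nat.succ_le_succ
        apply Nat.le_floor
        refine (b3 u v).trans (Real.rpow_le_rpow_of_exponent_le (by linarith) (by linarith)))
      have h0 : gnpProb n (p n) ∅ = 0 := by simp [gnpProb]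
      rw [h0, add_zero] at h
      exact h
    have h4 : {G | ¬ G ∈ A} = {G | ¬ ∃ T : SimpleGraph (Fin n), T.IsTree ∧ T ≤ G ∧
          (∀ u v : Fin n, (T.dist u v : ℝ) ≤ (n : ℝ) ^ ((1 : ℝ) / 18 - ε)) ∧
          Activates G T G} := rfl
    rw [← h4, h1]
    constructor <;> linarith
  refine tendsto_of_tendsto_of_tendsto_of_le_of_le' (g := fun n => 1 - UU n) (h := fun _ => 1)
    ?_ tendsto_const_nhds (hkey.mono fun n h => h.1) (hkey.mono fun n h => h.2)
  have := UU_tendsto.const_sub 1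
  rw [sub_zero] at this
  exact this

end WSat
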